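/- There exists d > 0 such that for every ε with 0 < ε < 1/2, every P5-free graph G has an induced subgraph F with |F| ≥ ε^d·|G| such that F is ε-restricted. (That is, P5 has the polynomial Rödl property.) -/

import Mathlib

open Finset
open scoped Classical

/-- A copy of `H` in `G`: an injective map preserving adjacency and non-adjacency. -/
def IsCopy {W V : Type*} (H : SimpleGraph W) (G : SimpleGraph V) (f : W → V) : Prop :=
  Function.Injective f ∧ ∀ u v : W, H.Adj u v ↔ G.Adj (f u) (f v)

/-- `G` is `H`-free: there is no copy of `H` in `G`. -/
def Free {W V : Type*} (H : SimpleGraph W) (G : SimpleGraph V) : Prop :=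
  ¬ ∃ f : W → V, IsCopy H G f

/-- The path on five vertices. -/
def P5 : SimpleGraph (Fin 5) := SimpleGraph.pathGraph 5

/-- The neighbours of `v` inside the finite set `A`. -/
noncomputable def nbrsIn {V : Type*} (G : SimpleGraph V) (v : V) (A : Finset V) : Finset V :=
  A.filter (fun u => G.Adj v u)

/-- `G` is `x`-sparse: every vertex has degree at most `x * |G|`. -/
def Sparse {V : Type*} [Fintype V] (G : SimpleGraph V) (x : ℝ) : Prop :=
  ∀ v : V, ((nbrsIn G v Finset.univ).card : ℝ) ≤ x * (Fintype.card V : ℝ)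

/-- `G` is `x`-restricted: `G` or its complement is `x`-sparse. -/
def Restricted {V : Type*} [Fintype V] (G : SimpleGraph V) (x : ℝ) : Prop :=
  Sparse G x ∨ Sparse Gᶜ x

/-- The induced subgraph `G[S]` is `x`-sparse. -/
def SparseOn {V : Type*} (G : SimpleGraph V) (S : Finset V) (x : ℝ) : Prop :=
  ∀ v ∈ S, ((nbrsIn G v S).card : ℝ) ≤ x * (S.card : ℝ)

/-- The induced subgraph `G[S]` is `x`-restricted: it or its complement is `x`-sparse. -/
def RestrictedOn {V : Type*} (G : SimpleGraph V) (S : Finset V) (x : ℝ) : Prop :=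
  SparseOn G S x ∨ SparseOn Gᶜ S x

/-- `(A, B)` is complete in `G`. -/
def CompletePair {V : Type*} (G : SimpleGraph V) (A B : Finset V) : Prop :=
  ∀ a ∈ A, ∀ b ∈ B, G.Adj a b

/-- `(A, B)` is anticomplete in `G`. -/
def AnticompletePair {V : Type*} (G : SimpleGraph V) (A B : Finset V) : Prop :=
  ∀ a ∈ A, ∀ b ∈ B, ¬ G.Adj a b

/-- `B` is `x`-sparse to `A` in `G`: every vertex of `B` has at most `x * |A|` neighbours in `A`. -/
def SparseTo {V : Type*} (G : SimpleGraph V) (x : ℝ) (A B : Finset V) : Prop :=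
  ∀ v ∈ B, ((nbrsIn G v A).card : ℝ) ≤ x * (A.card : ℝ)

/-- The number of edges of `G` between `A` and `B`. -/
noncomputable def edgesBetween {V : Type*} (G : SimpleGraph V) (A B : Finset V) : ℕ :=
  ((A ×ˢ B).filter (fun p => G.Adj p.1 p.2)).card

/-- `(A, B)` is weakly `x`-sparse in `G`. -/
def WeaklySparse {V : Type*} (G : SimpleGraph V) (x : ℝ) (A B : Finset V) : Prop :=
  (edgesBetween G A B : ℝ) ≤ x * (A.card : ℝ) * (B.card : ℝ)

/-- A blockade: a sequence of pairwise disjoint vertex subsets. -/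
def IsBlockade {V : Type*} {n : ℕ} (B : Fin n → Finset V) : Prop :=
  ∀ i j : Fin n, i ≠ j → Disjoint (B i) (B j)

/-- A pure blockade: every pair of distinct blocks is complete or anticomplete. -/
def PureBlockade {V : Type*} (G : SimpleGraph V) {n : ℕ} (B : Fin n → Finset V) : Prop :=
  ∀ i j : Fin n, i ≠ j → CompletePair G (B i) (B j) ∨ AnticompletePair G (B i) (B j)

/-- A complete blockade. -/
def CompleteBlockade {V : Type*} (G : SimpleGraph V) {n : ℕ} (B : Fin n → Finset V) : Prop :=
  ∀ i j : Fin n, i ≠ j → CompletePair G (B i) (B j)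

/-- An anticomplete blockade. -/
def AnticompleteBlockade {V : Type*} (G : SimpleGraph V) {n : ℕ} (B : Fin n → Finset V) : Prop :=
  ∀ i j : Fin n, i ≠ j → AnticompletePair G (B i) (B j)

/-- An `x`-sparse blockade: `B j` is `x`-sparse to `B i` whenever `i < j`. -/
def SparseBlockade {V : Type*} (G : SimpleGraph V) (x : ℝ) {n : ℕ} (B : Fin n → Finset V) : Prop :=
  ∀ i j : Fin n, i < j → SparseTo G x (B i) (B j)

/-- A comb: a blockade `Bl` together with distinct apexes `a i`, outside all blocks, such that
`a i` is adjacent to all of `Bl i` and nonadjacent to all of `Bl j` for `j ≠ i`. -/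
def IsComb {V : Type*} (G : SimpleGraph V) {k : ℕ} (a : Fin k → V) (Bl : Fin k → Finset V) :
    Prop :=
  IsBlockade Bl ∧ Function.Injective a ∧ (∀ i j : Fin k, a i ∉ Bl j) ∧
  (∀ i : Fin k, ∀ v ∈ Bl i, G.Adj (a i) v) ∧
  (∀ i j : Fin k, i ≠ j → ∀ v ∈ Bl j, ¬ G.Adj (a i) v)

lemma Free.false_of_path {V : Type*} {G : SimpleGraph V} (hG : Free P5 G) {a b c d e : V}
    (hab : G.Adj a b) (hbc : G.Adj b c) (hcd : G.Adj c d) (hde : G.Adj d e)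
    (hac : ¬ G.Adj a c) (had : ¬ G.Adj a d) (hae : ¬ G.Adj a e)
    (hbd : ¬ G.Adj b d) (hbe : ¬ G.Adj b e) (hce : ¬ G.Adj c e) : False := by
  have n1 : a ≠ c := by rintro rfl; exact had hcd
  have n2 : a ≠ d := by rintro rfl; exact hac hcd.symm
  have n3 : a ≠ e := by rintro rfl; exact had hde.symm
  have n4 : b ≠ d := by rintro rfl; exact hbe hde
  have n5 : b ≠ e := by rintro rfl; exact hae hab
  have n6 : c ≠ e := by rintro rfl; exact hbe hbc
  have hba := hab.symm
  have hcb := hbc.symm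
  have hdc := hcd.symm
  have hed := hde.symm
  have hca : ¬ G.Adj c a := fun h => hac h.symm
  have hda : ¬ G.Adj d a := fun h => had h.symm
  have hea : ¬ G.Adj e a := fun h => hae h.symm
  have hdb : ¬ G.Adj d b := fun h => hbd h.symm
  have heb : ¬ G.Adj e b := fun h => hbe h.symm
  have hec : ¬ G.Adj e c := fun h => hce h.symm
  refine hG ⟨![a, b, c, d, e], ?_, ?_⟩
  · intro i j h
    fin_cases i <;> fin_cases j <;> simp_all [hab.ne, hbc.ne, hcd.ne, hde.ne, hba.ne, hcb.ne,
      hdc.ne, hed.ne, n1.symm, n2.symm, n3.symm, n4.symm, n5.symm, n6.symm]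
  · intro i j
    fin_cases i <;> fin_cases j <;>
      simp [P5, SimpleGraph.pathGraph_adj, *]

/-- Markov's inequality with constant two. -/
lemma card_half_le_card_filter {α : Type*} (X : Finset α) (g : α → ℝ) (hg : ∀ x ∈ X, 0 ≤ g x)
    {r : ℝ} (hr : 0 < r) (h : ∑ x ∈ X, g x ≤ r * X.card) :
    (X.card : ℝ) / 2 ≤ ((X.filter fun x => g x ≤ 2 * r).card : ℝ) := by
  have h1 : ((X.filter fun x => ¬ g x ≤ 2 * r).card : ℝ) * (2 * r) ≤ ∑ x ∈ X, g x := by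
    calc ((X.filter fun x => ¬ g x ≤ 2 * r).card : ℝ) * (2 * r)
        = ∑ x ∈ X.filter fun x => ¬ g x ≤ 2 * r, 2 * r := by simp
      _ ≤ ∑ x ∈ X.filter fun x => ¬ g x ≤ 2 * r, g x := by
          refine sum_le_sum fun x hx => ?_
          simp only [mem_filter, not_le] at hx
          exact hx.2.le
      _ ≤ ∑ x ∈ X, g x :=
          sum_le_sum_of_subset_of_nonneg (filter_subset _ _) fun x hx _ => hg x hx
  have h2 : ((X.filter fun x => g x ≤ 2 * r).card : ℝ)
      + ((X.filter fun x => ¬ g x ≤ 2 * r).card : ℝ) = X.card := by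
    exact_mod_cast card_filter_add_card_filter_not (s := X) (fun x => g x ≤ 2 * r)
  nlinarith

lemma nbrsIn_subset {V : Type*} (G : SimpleGraph V) (v : V) (A : Finset V) :
    nbrsIn G v A ⊆ A := filter_subset _ _

lemma mem_nbrsIn {V : Type*} {G : SimpleGraph V} {v u : V} {A : Finset V} :
    u ∈ nbrsIn G v A ↔ u ∈ A ∧ G.Adj v u := mem_filter

lemma nbrsIn_mono {V : Type*} (G : SimpleGraph V) (v : V) {A B : Finset V} (h : A ⊆ B) :
    nbrsIn G v A ⊆ nbrsIn G v B := filter_subset_filter _ h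

/-- A set of small average degree contains half of its vertices inducing small maximum degree. -/
lemma exists_half_sparseOn {V : Type*} (G : SimpleGraph V) (X : Finset V) {r : ℝ} (hr : 0 < r)
    (h : ∑ x ∈ X, ((nbrsIn G x X).card : ℝ) ≤ r * X.card) :
    ∃ Y ⊆ X, (X.card : ℝ) / 2 ≤ Y.card ∧ ∀ y ∈ Y, ((nbrsIn G y Y).card : ℝ) ≤ 2 * r := by
  refine ⟨_, filter_subset _ _,
    card_half_le_card_filter X _ (fun x _ => Nat.cast_nonneg _) hr h, fun y hy => ?_⟩
  refine le_trans ?_ (mem_filter.1 hy).2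
  exact_mod_cast card_le_card (nbrsIn_mono G y (filter_subset _ _))

/-- A sparse `P5`-free graph contains two large disjoint sets with no edges between them. -/
lemma Free.exists_pair_of_sparse {V : Type*} {G : SimpleGraph V} (hG : Free P5 G) {c : ℝ}
    (hc0 : 0 < c) (hc : c ≤ 1 / 24) {X : Finset V} (h1 : 1 ≤ c * X.card)
    (hdeg : ∀ v ∈ X, ((nbrsIn G v X).card : ℝ) ≤ c * X.card) :
    ∃ Y ⊆ X, ∃ Z ⊆ X, c * X.card ≤ Y.card ∧ c * X.card ≤ Z.card ∧ CompletePair Gᶜ Y Z := by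
  by_contra hno
  have hpair : ∀ Y ⊆ X, ∀ Z ⊆ X, (∀ y ∈ Y, ∀ z ∈ Z, y ≠ z ∧ ¬ G.Adj y z) →
      c * X.card ≤ Y.card → (Z.card : ℝ) < c * X.card := by
    intro Y hY Z hZ hYZ h
    by_contra h'
    exact hno ⟨Y, hY, Z, hZ, h, not_lt.1 h', fun y hy z hz =>
      (SimpleGraph.compl_adj G y z).2 (hYZ y hy z hz)⟩
  set n : ℝ := (X.card : ℝ) with hn
  have hnpos : 0 < n := by
    by_contra h
    nlinarith
  have hcn : c * n ≤ n / 24 := by nlinarith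
  -- a largest union of components of at most half of the vertices
  obtain ⟨Z, hZ, hZmax⟩ := exists_max_image
    (X.powerset.filter fun Z => (∀ z ∈ Z, ∀ x ∈ X, G.Adj z x → x ∈ Z) ∧ (Z.card : ℝ) ≤ n / 2)
    card ⟨∅, by simp; positivity⟩
  simp only [mem_filter, mem_powerset] at hZ hZmax
  obtain ⟨hZX, hZcl, hZn⟩ := hZ
  have hX' : ((X \ Z).card : ℝ) = n - Z.card := by
    rw [card_sdiff_of_subset hZX, Nat.cast_sub (card_le_card hZX)]
  have hZc : (Z.card : ℝ) < c * n := by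
    refine hpair (X \ Z) sdiff_subset Z hZX (fun y hy z hz => ?_) (by rw [hX']; linarith)
    rw [mem_sdiff] at hy
    exact ⟨fun h => hy.2 (h ▸ hz), fun h => hy.2 (hZcl z hz y hy.1 h.symm)⟩
  have hcl : ∀ W ⊆ X \ Z, W.Nonempty → (∀ w ∈ W, ∀ x ∈ X \ Z, G.Adj w x → x ∈ W) →
      n / 2 - c * n < W.card := by
    intro W hW hne hWcl
    have hdisj : Disjoint W Z := disjoint_of_subset_left hW sdiff_disjoint
    have hcard : (W ∪ Z).card = W.card + Z.card := card_union_of_disjoint hdisj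
    by_contra hlt
    have := hZmax (W ∪ Z) ⟨union_subset (hW.trans sdiff_subset) hZX, ?_, ?_⟩
    · have := hne.card_pos
      omega
    · intro w hw x hx hwx
      rw [mem_union] at hw ⊢
      by_cases hxZ : x ∈ Z
      · exact Or.inr hxZ
      · rcases hw with hw | hw
        · exact Or.inl (hWcl w hw x (mem_sdiff.2 ⟨hx, hxZ⟩) hwx)
        · exact Or.inr (hZcl w hw x hx hwx)
    · rw [hcard]
      push_cast
      linarith
  set X' := X \ Z with hX'def
  have hX'X : X' ⊆ X := sdiff_subset
  let N : Finset V → Finset V := fun U => X'.filter fun x => x ∈ U ∨ ∃ u ∈ U, G.Adj u x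
  have hX'ne : X'.Nonempty := by
    rw [← card_pos, ← Nat.cast_pos (α := ℝ), hX']
    linarith
  obtain ⟨x0, hx0⟩ := hX'ne
  have hNw : ∀ w ∈ X, ((X'.filter fun x => G.Adj w x).card : ℝ) ≤ c * n := by
    intro w hw
    refine le_trans ?_ (hdeg w hw)
    exact_mod_cast card_le_card (filter_subset_filter _ hX'X)
  obtain ⟨U, hU, hUmax⟩ := exists_max_image
    (X'.powerset.filter fun U => U.Nonempty ∧ ((N U).card : ℝ) ≤ n / 3 ∧
      ∀ d, d ∉ U → (∃ u ∈ U, G.Adj d u) → (∃ u ∈ U, ¬ G.Adj d u) →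
        ∃ u ∈ U, ∃ u' ∈ U, G.Adj u u' ∧ G.Adj d u ∧ ¬ G.Adj d u')
    card ⟨{x0}, by
      simp only [mem_filter, mem_powerset, singleton_subset_iff, mem_singleton,
        singleton_nonempty, exists_eq_left, true_and]
      refine ⟨hx0, ?_, fun d _ h h' => absurd h h'⟩
      have : N {x0} ⊆ insert x0 (X'.filter fun x => G.Adj x0 x) := by
        intro x hx
        simp only [N, mem_filter, mem_singleton, exists_eq_left] at hx
        simp only [mem_insert, mem_filter]
        tauto
      have h2 : ((N {x0}).card : ℝ) ≤ (X'.filter fun x => G.Adj x0 x).card + 1 := by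
        exact_mod_cast (card_le_card this).trans (card_insert_le _ _)
      have := hNw x0 (hX'X hx0)
      linarith⟩
  simp only [mem_filter, mem_powerset] at hU hUmax
  obtain ⟨hUX', hUne, hUn, hUΦ⟩ := hU
  have hUN : U ⊆ N U := fun u hu => mem_filter.2 ⟨hUX' hu, Or.inl hu⟩
  have hUN' : (U.card : ℝ) ≤ (N U).card := by exact_mod_cast card_le_card hUN
  have hNUlarge : n / 3 - c * n < (N U).card := by
    have hex : ∃ w ∈ X', w ∉ U ∧ ∃ u ∈ U, G.Adj u w := by
      by_contra h
      push Not at h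
      have := hcl U hUX' hUne fun u hu x hx hux => by
        by_contra hxU
        exact h x hx hxU u hu hux
      linarith
    obtain ⟨w, hwX', hwU, u0, hu0, hu0w⟩ := hex
    by_contra hlt
    have hNi : N (insert w U) ⊆ N U ∪ X'.filter fun x => G.Adj w x := by
      intro x hx
      simp only [N, mem_filter, mem_insert, mem_union, exists_eq_or_imp] at hx ⊢
      rcases hx with ⟨hx, (rfl | h) | h | h⟩
      · exact Or.inl ⟨hx, Or.inr ⟨u0, hu0, hu0w⟩⟩
      · exact Or.inl ⟨hx, Or.inl h⟩
      · exact Or.inr ⟨hx, h⟩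
      · exact Or.inl ⟨hx, Or.inr h⟩
    have hNi' : ((N (insert w U)).card : ℝ) ≤ (N U).card + (X'.filter fun x => G.Adj w x).card := by
      exact_mod_cast (card_le_card hNi).trans (card_union_le _ _)
    have := hUmax (insert w U) ⟨insert_subset hwX' hUX', insert_nonempty _ _, ?_, ?_⟩
    · rw [card_insert_of_notMem hwU] at this
      omega
    · have := hNw w (hX'X hwX')
      linarith
    · intro d hd h h'
      simp only [mem_insert, not_or, exists_eq_or_imp] at hd h h' ⊢
      by_cases hA : ∃ u ∈ U, G.Adj d u
      · by_cases hB : ∃ u ∈ U, ¬ G.Adj d u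
        · obtain ⟨u, hu, u', hu', hh⟩ := hUΦ d hd.2 hA hB
          exact Or.inr ⟨u, hu, Or.inr ⟨u', hu', hh⟩⟩
        · have hdw : ¬ G.Adj d w := h'.resolve_right hB
          push Not at hB
          exact Or.inr ⟨u0, hu0, Or.inl ⟨hu0w, hB u0 hu0, hdw⟩⟩
      · have hdw : G.Adj d w := h.resolve_right hA
        push Not at hA
        exact Or.inl (Or.inr ⟨u0, hu0, hu0w.symm, hdw, hA u0 hu0⟩)
  set R := X' \ N U with hRdef
  have hRX : R ⊆ X := sdiff_subset.trans hX'X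
  have hUX : U ⊆ X := hUX'.trans hX'X
  have hNX' : N U ⊆ X' := filter_subset _ _
  have hRcard : (R.card : ℝ) = X'.card - (N U).card := by
    rw [hRdef, card_sdiff_of_subset hNX', Nat.cast_sub (card_le_card hNX')]
  have hRU : ∀ r ∈ R, ∀ u ∈ U, r ≠ u ∧ ¬ G.Adj r u := by
    intro r hr u hu
    simp only [hRdef, N, mem_sdiff, mem_filter, not_and, not_or, not_exists] at hr
    have := hr.2 hr.1
    exact ⟨fun h => this.1 (h ▸ hu), fun h => this.2 u hu h.symm⟩
  have hUc : (U.card : ℝ) < c * n :=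
    hpair R hRX U hUX hRU (by linarith)
  set D := N U \ U with hDdef
  have hDcard : (D.card : ℝ) = (N U).card - U.card := by
    rw [hDdef, card_sdiff_of_subset hUN, Nat.cast_sub (card_le_card hUN)]
  have hDX : D ⊆ X := sdiff_subset.trans (hNX'.trans hX'X)
  have hDR : ∀ d ∈ D, d ∉ R := fun d hd h => (mem_sdiff.1 h).2 (mem_sdiff.1 hd).1
  set D1 := D.filter fun d => ∀ r ∈ R, G.Adj d r → ∀ r' ∈ R, G.Adj r r' → G.Adj d r' with hD1
  have hbad : ∀ d ∈ D, d ∉ D1 → ∀ u ∈ U, G.Adj d u := by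
    intro d hd hd1 u hu
    simp only [hD1, mem_filter, not_and, not_forall] at hd1
    obtain ⟨r, hr, hdr, r', hr', hrr', hdr'⟩ := hd1 hd
    by_contra hdu
    rw [hDdef, mem_sdiff, mem_filter] at hd
    obtain ⟨⟨_, h | ⟨u1, hu1, h⟩⟩, hdU⟩ := hd
    · exact hdU h
    · obtain ⟨a, ha, a', ha', haa', hda, hda'⟩ := hUΦ d hdU ⟨u1, hu1, h.symm⟩ ⟨u, hu, hdu⟩
      exact hG.false_of_path haa'.symm hda.symm hdr hrr' (fun h => hda' h.symm)
        (fun h => (hRU r hr a' ha').2 h.symm) (fun h => (hRU r' hr' a' ha').2 h.symm)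
        (fun h => (hRU r hr a ha).2 h.symm) (fun h => (hRU r' hr' a ha).2 h.symm) hdr'
  let M : Finset V → Finset V := fun K => R.filter fun r => ∃ d ∈ K, G.Adj d r
  have hMpair : ∀ K ⊆ D1, ∀ r ∈ M K, ∀ r' ∈ R \ M K, r ≠ r' ∧ ¬ G.Adj r r' := by
    intro K hK r hr r' hr'
    simp only [M, mem_sdiff, mem_filter, not_and, not_exists] at hr hr'
    obtain ⟨hrR, d, hdK, hdr⟩ := hr
    refine ⟨?_, fun h => ?_⟩
    · rintro rfl
      exact hr'.2 hrR d hdK hdr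
    · exact hr'.2 hr'.1 d hdK ((mem_filter.1 (hK hdK)).2 r hrR hdr r' hr'.1 h)
  have hMsub : ∀ K, M K ⊆ R := fun K => filter_subset _ _
  have hMcard : ∀ K, ((R \ M K).card : ℝ) = R.card - (M K).card := fun K => by
    rw [card_sdiff_of_subset (hMsub K), Nat.cast_sub (card_le_card (hMsub K))]
  have hM1 : ((M D1).card : ℝ) < c * n := by
    by_contra hge
    obtain ⟨K, hK, hKmin⟩ := exists_min_image
      (D1.powerset.filter fun K => c * n ≤ ((M K).card : ℝ)) card
      ⟨D1, by simpa using hge⟩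
    simp only [mem_filter, mem_powerset] at hK hKmin
    have hKne : K.Nonempty := by
      rw [nonempty_iff_ne_empty]
      rintro rfl
      have : ((M ∅).card : ℝ) = 0 := by simp [M]
      linarith [hK.2]
    obtain ⟨d, hd⟩ := hKne
    have hlt : ((M (K.erase d)).card : ℝ) < c * n := by
      by_contra hge'
      have := hKmin (K.erase d) ⟨(erase_subset _ _).trans hK.1, not_lt.1 hge'⟩
      have := card_erase_lt_of_mem hd
      omega
    have hsub : M K ⊆ M (K.erase d) ∪ X'.filter fun x => G.Adj d x := by
      intro r hr
      simp only [M, mem_filter, mem_union, mem_erase] at hr ⊢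
      obtain ⟨hr, d', hd', h⟩ := hr
      by_cases hdd : d' = d
      · exact Or.inr ⟨(mem_sdiff.1 hr).1, hdd ▸ h⟩
      · exact Or.inl ⟨hr, d', ⟨hdd, hd'⟩, h⟩
    have hsub' : ((M K).card : ℝ) ≤
        (M (K.erase d)).card + (X'.filter fun x => G.Adj d x).card := by
      exact_mod_cast (card_le_card hsub).trans (card_union_le _ _)
    have h2 := hNw d (hDX ((mem_filter.1 (hK.1 hd)).1))
    have h3 := hpair (M K) ((hMsub K).trans hRX) (R \ M K) (sdiff_subset.trans hRX)
      (hMpair K hK.1) hK.2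
    rw [hMcard] at h3
    linarith
  have hD1c : (D1.card : ℝ) < c * n := by
    refine hpair (R \ M D1) (sdiff_subset.trans hRX) D1 ((filter_subset _ _).trans hDX) ?_ ?_
    · intro r hr d hd
      simp only [M, mem_sdiff, mem_filter, not_and, not_exists] at hr
      exact ⟨fun h => hDR d (mem_filter.1 hd).1 (h ▸ hr.1), fun h => hr.2 hr.1 d hd h.symm⟩
    · rw [hMcard]
      linarith
  obtain ⟨u, hu⟩ := hUne
  have hsub : D ⊆ D1 ∪ X'.filter fun x => G.Adj u x := by
    intro d hd
    by_cases h : d ∈ D1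
    · exact mem_union_left _ h
    · exact mem_union_right _ (mem_filter.2 ⟨hNX' (mem_sdiff.1 hd).1, (hbad d hd h u hu).symm⟩)
  have hsub' : (D.card : ℝ) ≤ D1.card + (X'.filter fun x => G.Adj u x).card := by
    exact_mod_cast (card_le_card hsub).trans (card_union_le _ _)
  have := hNw u (hUX hu)
  linarith

lemma CompletePair.mono {V : Type*} {R : SimpleGraph V} {X Y X' Y' : Finset V}
    (h : CompletePair R X Y) (hX : X' ⊆ X) (hY : Y' ⊆ Y) : CompletePair R X' Y' :=
  fun a ha b hb => h a (hX ha) b (hY hb)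

lemma CompletePair.symm {V : Type*} {R : SimpleGraph V} {X Y : Finset V}
    (h : CompletePair R X Y) : CompletePair R Y X :=
  fun a ha b hb => (h b hb a ha).symm

lemma CompletePair.disjoint {V : Type*} {R : SimpleGraph V} {X Y : Finset V}
    (h : CompletePair R X Y) : Disjoint X Y :=
  disjoint_left.2 fun a ha hb => (h a ha a hb).ne rfl

/-- Replacing each block of a pairwise complete family by such a family of subsets. -/
lemma pairwise_completePair_biUnion {V : Type*} {R : SimpleGraph V} {𝓐 : Finset (Finset V)}
    (h𝓐 : (𝓐 : Set (Finset V)).Pairwise (CompletePair R)) (𝓕 : Finset V → Finset (Finset V))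
    (hsub : ∀ X ∈ 𝓐, ∀ Y ∈ 𝓕 X, Y ⊆ X) (hne : ∀ X ∈ 𝓐, ∀ Y ∈ 𝓕 X, Y.Nonempty)
    (hp : ∀ X ∈ 𝓐, (𝓕 X : Set (Finset V)).Pairwise (CompletePair R)) :
    ((𝓐.biUnion 𝓕 : Finset (Finset V)) : Set (Finset V)).Pairwise (CompletePair R) ∧
      (𝓐.biUnion 𝓕).card = ∑ X ∈ 𝓐, (𝓕 X).card := by
  constructor
  · intro Y hY Y' hY' hYY'
    simp only [coe_biUnion, Set.mem_iUnion, mem_coe] at hY hY'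
    obtain ⟨X, hX, hYX⟩ := hY
    obtain ⟨X', hX', hYX'⟩ := hY'
    by_cases h : X = X'
    · subst h
      exact hp X hX hYX hYX' hYY'
    · exact (h𝓐 hX hX' h).mono (hsub X hX Y hYX) (hsub X' hX' Y' hYX')
  · refine card_biUnion fun X hX X' hX' h => disjoint_left.2 fun Y hY hY' => ?_
    obtain ⟨y, hy⟩ := hne X hX Y hY
    exact disjoint_left.1 (h𝓐 hX hX' h).disjoint (hsub X hX Y hY hy) (hsub X' hX' Y hY' hy)

lemma Free.exists_family_of_sparse {V : Type*} {G : SimpleGraph V} (hG : Free P5 G) {c : ℝ}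
    (hc0 : 0 < c) (hc : c ≤ 1 / 24) (t : ℕ) : ∀ X : Finset V, 1 ≤ c ^ (t + 1) * X.card →
    (∀ v ∈ X, ((nbrsIn G v X).card : ℝ) ≤ c ^ (t + 1) * X.card) →
    ∃ 𝓕 : Finset (Finset V), 2 ^ t ≤ 𝓕.card ∧ (∀ Y ∈ 𝓕, Y ⊆ X ∧ c ^ t * X.card ≤ Y.card) ∧
      (𝓕 : Set (Finset V)).Pairwise (CompletePair Gᶜ) := by
  induction t with
  | zero =>
    intro X _ _
    exact ⟨{X}, by simp, by simp, by simp⟩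
  | succ t ih =>
    intro X h1 hdeg
    have hc1 : c ^ (t + 1 + 1) ≤ c := by
      calc c ^ (t + 1 + 1) ≤ c ^ 1 := pow_le_pow_of_le_one hc0.le (by linarith) (by omega)
        _ = c := pow_one c
    have hX0 : (0 : ℝ) ≤ X.card := Nat.cast_nonneg _
    obtain ⟨Y, hY, Z, hZ, hYc, hZc, hYZ⟩ := hG.exists_pair_of_sparse hc0 hc (X := X)
      (h1.trans (by gcongr)) fun v hv => (hdeg v hv).trans (by gcongr)
    have key : ∀ W ⊆ X, c * X.card ≤ W.card → ∃ 𝓕 : Finset (Finset V), 2 ^ t ≤ 𝓕.card ∧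
        (∀ Y ∈ 𝓕, Y ⊆ W ∧ c ^ (t + 1) * X.card ≤ Y.card) ∧
        (𝓕 : Set (Finset V)).Pairwise (CompletePair Gᶜ) := by
      intro W hW hWc
      have h2 : c ^ (t + 1 + 1) * X.card ≤ c ^ (t + 1) * W.card := by
        rw [pow_succ, mul_assoc]
        gcongr
      obtain ⟨𝓕, h3, h4, h5⟩ := ih W (h1.trans h2) fun v hv => by
        refine le_trans ?_ ((hdeg v (hW hv)).trans h2)
        exact_mod_cast card_le_card (nbrsIn_mono G v hW)
      refine ⟨𝓕, h3, fun Y hY => ⟨(h4 Y hY).1, le_trans ?_ (h4 Y hY).2⟩, h5⟩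
      rw [pow_succ, mul_assoc]
      gcongr
    obtain ⟨𝓕, h3, h4, h5⟩ := key Y hY hYc
    obtain ⟨𝓖, h6, h7, h8⟩ := key Z hZ hZc
    have hpos : (0 : ℝ) < X.card := by
      by_contra h
      have : (X.card : ℝ) = 0 := le_antisymm (not_lt.1 h) hX0
      rw [this, mul_zero] at h1
      linarith
    have hdis : ∀ A ∈ 𝓕, ∀ B ∈ 𝓖, CompletePair Gᶜ A B := fun A hA B hB =>
      hYZ.mono (h4 A hA).1 (h7 B hB).1
    refine ⟨𝓕 ∪ 𝓖, ?_, ?_, ?_⟩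
    · rw [card_union_of_disjoint, pow_succ]
      · omega
      · refine disjoint_left.2 fun A hA hA' => ?_
        have : (0 : ℝ) < A.card := lt_of_lt_of_le (by positivity) (h4 A hA).2
        obtain ⟨a, ha⟩ := card_pos.1 (Nat.cast_pos.1 this)
        exact (hdis A hA A hA' a ha a ha).ne rfl
    · intro A hA
      rcases mem_union.1 hA with h | h
      · exact ⟨(h4 A h).1.trans hY, (h4 A h).2⟩
      · exact ⟨(h7 A h).1.trans hZ, (h7 A h).2⟩
    · intro A hA B hB hAB
      simp only [coe_union, Set.mem_union, mem_coe] at hA hB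
      rcases hA with hA | hA <;> rcases hB with hB | hB
      · exact h5 hA hB hAB
      · exact hdis A hA B hB
      · exact (hdis B hB A hA).symm
      · exact h8 hA hB hAB

/-- Either a pattern embeds with prescribed vertex sets, or two of the sets contain large subsets
that are sparse to each other in the graph or in its complement. -/
lemma exists_embedding_or_sparse_pair {δ : ℝ} (hδ0 : 0 < δ) (k : ℕ) :
    ∃ γ : ℝ, 0 < γ ∧ ∀ {V : Type*} (G : SimpleGraph V) (H : SimpleGraph (Fin k))
      (W : Fin k → Finset V) (n : ℝ), 0 < n → (∀ i, n ≤ (W i).card) →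
      (∃ f : Fin k → V, (∀ i, f i ∈ W i) ∧ ∀ i j, i ≠ j →
        (H.Adj i j → G.Adj (f i) (f j)) ∧ (¬ H.Adj i j → Gᶜ.Adj (f i) (f j))) ∨
      ∃ i j, i ≠ j ∧ ∃ A ⊆ W i, ∃ B ⊆ W j, γ * n ≤ A.card ∧ γ * n ≤ B.card ∧
        ∃ R : SimpleGraph V, (R = G ∨ R = Gᶜ) ∧
          ∀ a ∈ A, ((nbrsIn R a B).card : ℝ) ≤ δ * B.card := by
  induction k with
  | zero => exact ⟨1, one_pos, fun G H W n _ _ => Or.inl ⟨Fin.elim0, fun i => i.elim0,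
      fun i => i.elim0⟩⟩
  | succ k ih =>
    obtain ⟨γ, hγ, ih⟩ := ih
    refine ⟨min (γ * δ) (1 / (k + 1)), by positivity, fun {V} G H W n hn hW => ?_⟩
    have hk : (0 : ℝ) < k + 1 := by positivity
    let R : Fin k → SimpleGraph V := fun j => if H.Adj 0 j.succ then G else Gᶜ
    have hR : ∀ j, R j = G ∨ R j = Gᶜ := fun j => by
      simp only [R]
      split_ifs <;> simp
    by_cases hv : ∃ v ∈ W 0, ∀ j : Fin k,
        δ * (W j.succ).card < ((nbrsIn (R j) v (W j.succ)).card : ℝ)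
    · obtain ⟨v, hv0, hv⟩ := hv
      rcases ih G (H.comap Fin.succ) (fun j => nbrsIn (R j) v (W j.succ)) (δ * n) (by positivity)
        (fun j => le_trans (by gcongr; exact hW _) (hv j).le) with ⟨f, hf, hf'⟩ | h
      · left
        have hadj : ∀ j,
            (H.Adj 0 j.succ → G.Adj v (f j)) ∧ (¬ H.Adj 0 j.succ → Gᶜ.Adj v (f j)) := by
          intro j
          have := (mem_nbrsIn.1 (hf j)).2
          simp only [R] at this
          split_ifs at this with h
          · exact ⟨fun _ => this, fun h' => absurd h h'⟩
          · exact ⟨fun h' => absurd h' h, fun _ => this⟩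
        refine ⟨Fin.cons v f, fun i => ?_, fun i j hij => ?_⟩
        · refine Fin.cases ?_ (fun i => ?_) i
          · simpa using hv0
          · simpa using (mem_nbrsIn.1 (hf i)).1
        · induction i using Fin.cases with
          | zero =>
            induction j using Fin.cases with
            | zero => exact absurd rfl hij
            | succ j => simpa using hadj j
          | succ i =>
            induction j using Fin.cases with
            | zero =>
              rw [Fin.cons_succ, Fin.cons_zero, H.adj_comm, G.adj_comm, Gᶜ.adj_comm]
              exact hadj i
            | succ j =>
              rw [Fin.cons_succ, Fin.cons_succ]
              exact hf' i j fun h => hij (by rw [h])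
      · right
        obtain ⟨i, j, hij, A, hA, B, hB, hAc, hBc, h⟩ := h
        refine ⟨i.succ, j.succ, fun h => hij (Fin.succ_injective _ h), A,
          hA.trans (nbrsIn_subset _ _ _), B, hB.trans (nbrsIn_subset _ _ _),
          le_trans ?_ hAc, le_trans ?_ hBc, h⟩ <;>
        · rw [← mul_assoc]
          gcongr
          exact min_le_left _ _
    · right
      push Not at hv
      have hcover : W 0 ⊆ univ.biUnion fun j : Fin k => (W 0).filter fun v =>
          ((nbrsIn (R j) v (W j.succ)).card : ℝ) ≤ δ * (W j.succ).card := by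
        intro v hv'
        obtain ⟨j, hj⟩ := hv v hv'
        exact mem_biUnion.2 ⟨j, mem_univ _, mem_filter.2 ⟨hv', hj⟩⟩
      have hex : ∃ j : Fin k, n / (k + 1) ≤ (((W 0).filter fun v =>
          ((nbrsIn (R j) v (W j.succ)).card : ℝ) ≤ δ * (W j.succ).card).card : ℝ) := by
        by_contra hlt
        push Not at hlt
        have h1 : ((W 0).card : ℝ) ≤ ∑ j : Fin k, (((W 0).filter fun v =>
            ((nbrsIn (R j) v (W j.succ)).card : ℝ) ≤ δ * (W j.succ).card).card : ℝ) := by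
          exact_mod_cast (card_le_card hcover).trans card_biUnion_le
        have h2 := h1.trans (sum_le_sum fun j _ => (hlt j).le)
        simp only [sum_const, card_univ, Fintype.card_fin, nsmul_eq_mul] at h2
        have h3 := (hW 0).trans h2
        have h4 : (k : ℝ) * (n / (k + 1)) < n := by
          rw [mul_div_assoc', div_lt_iff₀ hk]
          nlinarith
        linarith
      obtain ⟨j, hj⟩ := hex
      refine ⟨0, j.succ, (Fin.succ_ne_zero j).symm, _, filter_subset _ _, W j.succ, subset_rfl,
        le_trans ?_ hj, ?_, R j, hR j, fun a ha => (mem_filter.1 ha).2⟩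
      · calc min (γ * δ) (1 / ((k : ℝ) + 1)) * n ≤ 1 / (k + 1) * n :=
              mul_le_mul_of_nonneg_right (min_le_right _ _) hn.le
          _ = n / (k + 1) := by ring
      · refine le_trans ?_ (hW _)
        have : min (γ * δ) (1 / ((k : ℝ) + 1)) ≤ 1 := by
          refine (min_le_right _ _).trans ?_
          rw [div_le_one hk]
          linarith [(Nat.cast_nonneg k : (0 : ℝ) ≤ k)]
        nlinarith

lemma sum_card_nbrsIn_comm {V : Type*} (R : SimpleGraph V) (A B : Finset V) :
    ∑ a ∈ A, (nbrsIn R a B).card = ∑ b ∈ B, (nbrsIn R b A).card := by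
  have := sum_card_bipartiteAbove_eq_sum_card_bipartiteBelow (s := A) (t := B) R.Adj
  simpa [bipartiteAbove, bipartiteBelow, nbrsIn, R.adj_comm] using this

/-- Two sets of different sizes, one sparse to the other, can be trimmed to equal sizes. -/
lemma exists_trim_pair {V : Type*} (R : SimpleGraph V) {δ : ℝ} (hδ0 : 0 < δ) {A B : Finset V}
    (hAB : ∀ a ∈ A, ((nbrsIn R a B).card : ℝ) ≤ δ * B.card) (hA : A.Nonempty) (hB : B.Nonempty) :
    ∃ s : ℕ, min (A.card : ℝ) B.card / 2 ≤ s ∧ ∃ A' ⊆ A, ∃ B' ⊆ B, A'.card = s ∧ B'.card = s ∧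
      ∀ a ∈ A', ((nbrsIn R a B').card : ℝ) ≤ 4 * δ * s := by
  obtain ⟨A1, hA1, hA1c⟩ := exists_subset_card_eq (min_le_left A.card B.card)
  have hs0 : 0 < min A.card B.card := lt_min hA.card_pos hB.card_pos
  set s0 := min A.card B.card with hs0def
  have hs0' : (0 : ℝ) < s0 := by exact_mod_cast hs0
  have h1 : ∑ b ∈ B, ((nbrsIn R b A1).card : ℝ) ≤ (δ * s0) * B.card := by
    have : ∑ b ∈ B, ((nbrsIn R b A1).card : ℝ) = ∑ a ∈ A1, ((nbrsIn R a B).card : ℝ) := by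
      exact_mod_cast (sum_card_nbrsIn_comm R A1 B).symm
    rw [this]
    refine (sum_le_sum fun a ha => hAB a (hA1 ha)).trans (le_of_eq ?_)
    rw [sum_const, hA1c, nsmul_eq_mul]
    ring
  have h2 := card_half_le_card_filter B _ (fun b _ => Nat.cast_nonneg _) (by positivity) h1
  have hsB : (s0 : ℝ) ≤ B.card := by exact_mod_cast min_le_right A.card B.card
  set s : ℕ := (s0 + 1) / 2 with hs
  have h2s : s0 ≤ 2 * s := by omega
  have hle : ∀ k : ℕ, (s0 : ℝ) / 2 ≤ k → s ≤ k := by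
    intro k hk
    have : s0 ≤ 2 * k := by
      have : (s0 : ℝ) ≤ 2 * k := by linarith
      exact_mod_cast this
    omega
  have h2s' : (s0 : ℝ) ≤ 2 * s := by exact_mod_cast h2s
  have hspos : (0 : ℝ) < s := by linarith
  obtain ⟨B2, hB2, hB2c⟩ := exists_subset_card_eq (hle _ (le_trans (by linarith) h2))
  have h3 : ∑ a ∈ A1, ((nbrsIn R a B2).card : ℝ) ≤ (2 * δ * s) * A1.card := by
    have : ∑ a ∈ A1, ((nbrsIn R a B2).card : ℝ) = ∑ b ∈ B2, ((nbrsIn R b A1).card : ℝ) := by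
      exact_mod_cast sum_card_nbrsIn_comm R A1 B2
    rw [this]
    refine (sum_le_sum fun b hb => (mem_filter.1 (hB2 hb)).2).trans (le_of_eq ?_)
    rw [sum_const, hB2c, hA1c, nsmul_eq_mul]
    ring
  have h4 := card_half_le_card_filter A1 _ (fun b _ => Nat.cast_nonneg _) (by positivity) h3
  rw [hA1c] at h4
  obtain ⟨A3, hA3, hA3c⟩ := exists_subset_card_eq (hle _ h4)
  refine ⟨s, ?_, A3, hA3.trans ((filter_subset _ _).trans hA1), B2,
    hB2.trans (filter_subset _ _), hA3c, hB2c, fun a ha => ?_⟩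
  · rw [← Nat.cast_min]
    linarith
  · have := (mem_filter.1 (hA3 ha)).2
    linarith

lemma exists_disjoint_subsets {V : Type*} (X : Finset V) (n : ℕ) : ∀ k : ℕ, k * n ≤ X.card →
    ∃ W : Fin k → Finset V, (∀ i, W i ⊆ X ∧ (W i).card = n) ∧
      ∀ i j, i ≠ j → Disjoint (W i) (W j) := by
  intro k
  induction k generalizing X with
  | zero => exact fun _ => ⟨Fin.elim0, fun i => i.elim0, fun i => i.elim0⟩
  | succ k ih =>
    intro h
    have h' : k * n + n ≤ X.card := by rwa [Nat.succ_mul] at h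
    obtain ⟨Y, hY, hYc⟩ := exists_subset_card_eq (show n ≤ X.card by omega)
    obtain ⟨W, hW, hd⟩ := ih (X \ Y) (by rw [card_sdiff_of_subset hY]; omega)
    have hYW : ∀ i, Disjoint Y (W i) := fun i =>
      disjoint_of_subset_right (hW i).1 disjoint_sdiff
    refine ⟨Fin.cons Y W, fun i => ?_, fun i j hij => ?_⟩
    · refine Fin.cases ?_ (fun i => ?_) i
      · simpa using ⟨hY, hYc⟩
      · simpa using ⟨(hW i).1.trans sdiff_subset, (hW i).2⟩
    · induction i using Fin.cases with
      | zero =>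
        induction j using Fin.cases with
        | zero => exact absurd rfl hij
        | succ j => simpa using hYW j
      | succ i =>
        induction j using Fin.cases with
        | zero => simpa using (hYW i).symm
        | succ j => simpa using hd i j fun h => hij (by rw [h])

lemma exists_sparse_pair {δ : ℝ} (hδ0 : 0 < δ) :
    ∃ γ : ℝ, 0 < γ ∧ γ ≤ 1 ∧ ∀ {V : Type*} {G : SimpleGraph V}, Free P5 G → ∀ X : Finset V,
      5 ≤ X.card → ∃ s : ℕ, γ * X.card ≤ s ∧ ∃ A ⊆ X, ∃ B ⊆ X, A.card = s ∧ B.card = s ∧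
        Disjoint A B ∧ ∃ R : SimpleGraph V, (R = G ∨ R = Gᶜ) ∧
          ∀ a ∈ A, ((nbrsIn R a B).card : ℝ) ≤ δ * s := by
  obtain ⟨γ, hγ, key⟩ := exists_embedding_or_sparse_pair (δ := δ / 4) (by positivity) 5
  refine ⟨min (γ / 20) 1, by positivity, min_le_right _ _, fun {V} {G} hG X hX => ?_⟩
  obtain ⟨W, hW, hd⟩ := exists_disjoint_subsets X (X.card / 5) 5 (by omega)
  have hn : (X.card : ℝ) / 10 ≤ (X.card / 5 : ℕ) := by
    have : X.card ≤ 10 * (X.card / 5) := by omega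
    have : (X.card : ℝ) ≤ 10 * (X.card / 5 : ℕ) := by exact_mod_cast this
    linarith
  have hpos : (0 : ℝ) < X.card := by
    have : 0 < X.card := by omega
    exact_mod_cast this
  rcases key G P5 W (X.card / 10) (by positivity) (fun i => by rw [(hW i).2]; exact hn) with
    ⟨f, -, hf⟩ | ⟨i, j, hij, A, hA, B, hB, hAc, hBc, R, hR, hAB⟩
  · refine absurd ⟨f, fun i j hij => ?_, fun i j => ⟨fun h => ?_, fun h => ?_⟩⟩ hG
    · by_contra hne
      by_cases h : P5.Adj i j
      · exact ((hf i j hne).1 h).ne hij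
      · exact ((hf i j hne).2 h).ne hij
    · exact (hf i j h.ne).1 h
    · by_contra h'
      have hne : i ≠ j := fun hij => h.ne (by rw [hij])
      exact ((SimpleGraph.compl_adj _ _ _).1 ((hf i j hne).2 h')).2 h
  · have hApos : (0 : ℝ) < A.card := lt_of_lt_of_le (by positivity) hAc
    have hBpos : (0 : ℝ) < B.card := lt_of_lt_of_le (by positivity) hBc
    obtain ⟨s, hs, A', hA', B', hB', hA'c, hB'c, h⟩ := exists_trim_pair R (by positivity) hAB
      (card_pos.1 (by exact_mod_cast hApos)) (card_pos.1 (by exact_mod_cast hBpos))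
    refine ⟨s, le_trans ?_ hs, A', hA'.trans (hA.trans (hW i).1), B', hB'.trans (hB.trans (hW j).1),
      hA'c, hB'c, disjoint_of_subset_left (hA'.trans hA) (disjoint_of_subset_right (hB'.trans hB)
        (hd i j hij)), R, hR, fun a ha => (h a ha).trans (le_of_eq (by ring))⟩
    have h1 : min (γ / 20) 1 * (X.card : ℝ) ≤ γ / 20 * X.card := by
      gcongr
      exact min_le_left _ _
    have h2 := le_min hAc hBc
    linarith

/-- Adding a set to a sparse set to which it is sparse. -/
lemma sum_card_nbrsIn_union_le {V : Type*} (R : SimpleGraph V) {A U B : Finset V} {s : ℕ}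
    (hA : A.card = s) (hUB : U ⊆ B) (hAB : Disjoint A B)
    (h : ∀ a ∈ A, ((nbrsIn R a B).card : ℝ) ≤ s / 2) :
    ∑ x ∈ A ∪ U, ((nbrsIn R x (A ∪ U)).card : ℝ) ≤
      ∑ x ∈ U, ((nbrsIn R x U).card : ℝ) + 2 * s ^ 2 := by
  have hAU : Disjoint A U := disjoint_of_subset_right hUB hAB
  have hsplit : ∀ x, ((nbrsIn R x (A ∪ U)).card : ℝ) ≤
      (nbrsIn R x A).card + (nbrsIn R x U).card := by
    intro x
    have : nbrsIn R x (A ∪ U) ⊆ nbrsIn R x A ∪ nbrsIn R x U := by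
      intro y
      simp only [mem_nbrsIn, mem_union]
      tauto
    exact_mod_cast (card_le_card this).trans (card_union_le _ _)
  have h1 : ∑ a ∈ A, ((nbrsIn R a U).card : ℝ) ≤ s ^ 2 / 2 := by
    calc ∑ a ∈ A, ((nbrsIn R a U).card : ℝ) ≤ ∑ a ∈ A, (s : ℝ) / 2 := by
          refine sum_le_sum fun a ha => le_trans ?_ (h a ha)
          exact_mod_cast card_le_card (nbrsIn_mono R a hUB)
      _ = s ^ 2 / 2 := by
          rw [sum_const, hA, nsmul_eq_mul]
          ring
  have h2 : ∑ u ∈ U, ((nbrsIn R u A).card : ℝ) = ∑ a ∈ A, ((nbrsIn R a U).card : ℝ) := by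
    exact_mod_cast (sum_card_nbrsIn_comm R A U).symm
  have h3 : ∑ a ∈ A, ((nbrsIn R a A).card : ℝ) ≤ s ^ 2 := by
    calc ∑ a ∈ A, ((nbrsIn R a A).card : ℝ) ≤ ∑ a ∈ A, (s : ℝ) := by
          refine sum_le_sum fun a ha => ?_
          rw [← hA]
          exact_mod_cast card_le_card (nbrsIn_subset R a A)
      _ = s ^ 2 := by
          rw [sum_const, hA, nsmul_eq_mul]
          ring
  rw [sum_union hAU]
  have h4 := sum_le_sum fun a (_ : a ∈ A) => hsplit a
  have h5 := sum_le_sum fun a (_ : a ∈ U) => hsplit a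
  rw [sum_add_distrib] at h4 h5
  linarith

lemma exists_sparse_union (p q : ℕ) :
    ∃ r : ℝ, 0 < r ∧ r ≤ 1 / 5 ∧ ∀ {V : Type*} {G : SimpleGraph V}, Free P5 G → ∀ X : Finset V,
      1 ≤ r * X.card → ∃ s : ℕ, r * X.card ≤ s ∧ s ≤ X.card ∧ ∃ U ⊆ X,
        (U.card = p * s ∧ ∑ x ∈ U, ((nbrsIn G x U).card : ℝ) ≤ 2 * p * s ^ 2) ∨
        (U.card = q * s ∧ ∑ x ∈ U, ((nbrsIn Gᶜ x U).card : ℝ) ≤ 2 * q * s ^ 2) := by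
  induction p generalizing q with
  | zero =>
    refine ⟨1 / 5, by norm_num, le_rfl, fun {V G} _ X _ => ⟨X.card, ?_, le_rfl, ∅,
      empty_subset _, Or.inl (by simp)⟩⟩
    have := (Nat.cast_nonneg X.card : (0 : ℝ) ≤ X.card)
    linarith
  | succ p ihp =>
    induction q with
    | zero =>
      refine ⟨1 / 5, by norm_num, le_rfl, fun {V G} _ X _ => ⟨X.card, ?_, le_rfl, ∅,
        empty_subset _, Or.inr (by simp)⟩⟩
      have := (Nat.cast_nonneg X.card : (0 : ℝ) ≤ X.card)
      linarith
    | succ q ihq =>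
      obtain ⟨r1, hr1, hr1', h1⟩ := ihp (q + 1)
      obtain ⟨r2, hr2, hr2', h2⟩ := ihq
      obtain ⟨γ, hγ, hγ1, h3⟩ := exists_sparse_pair (δ := min r1 r2 / 2) (by positivity)
      have hρ : 0 < min r1 r2 := by positivity
      have hρ1 : min r1 r2 ≤ r1 := min_le_left _ _
      have hρ2 : min r1 r2 ≤ r2 := min_le_right _ _
      refine ⟨γ * min r1 r2, by positivity, by nlinarith, fun {V G} hG X hX => ?_⟩
      have hX0 : (0 : ℝ) ≤ X.card := Nat.cast_nonneg _
      have hX5 : 5 ≤ X.card := by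
        have h4 : γ * min r1 r2 ≤ 1 / 5 := by nlinarith
        have : (5 : ℝ) ≤ X.card := by nlinarith
        exact_mod_cast this
      obtain ⟨s0, hs0, A, hA, B, hB, hAc, hBc, hAB, R, hR, hd⟩ := h3 hG X hX5
      have hs00 : (0 : ℝ) ≤ s0 := Nat.cast_nonneg _
      have hγs : γ * min r1 r2 * X.card ≤ min r1 r2 * s0 := by
        have := mul_le_mul_of_nonneg_left hs0 hρ.le
        linarith
      have hs0X : s0 ≤ X.card := hAc ▸ card_le_card hA
      have ext : ∀ (R : SimpleGraph V) (s t : ℕ) (U : Finset V), s ≤ s0 → U ⊆ B →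
          min r1 r2 * s0 ≤ s → U.card = t * s →
          ∑ x ∈ U, ((nbrsIn R x U).card : ℝ) ≤ 2 * t * s ^ 2 →
          (∀ a ∈ A, ((nbrsIn R a B).card : ℝ) ≤ min r1 r2 / 2 * s0) →
          ∃ U ⊆ X, U.card = (t + 1) * s ∧
            ∑ x ∈ U, ((nbrsIn R x U).card : ℝ) ≤ 2 * (t + 1 : ℕ) * s ^ 2 := by
        intro R s t U hs hU hs' hUc hsum hd
        obtain ⟨A', hA', hA'c⟩ := exists_subset_card_eq (hs.trans_eq hAc.symm)
        have hA'B : Disjoint A' B := disjoint_of_subset_left hA' hAB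
        refine ⟨A' ∪ U, union_subset (hA'.trans hA) (hU.trans hB), ?_, ?_⟩
        · rw [card_union_of_disjoint (disjoint_of_subset_right hU hA'B), hA'c, hUc]
          ring
        · have := sum_card_nbrsIn_union_le R hA'c hU hA'B fun a ha =>
            (hd a (hA' ha)).trans (by linarith)
          push_cast
          linarith
      rcases hR with rfl | rfl
      · obtain ⟨s, hs, hsB, U, hU, h⟩ := h1 hG B (by
          rw [hBc]
          nlinarith)
        rw [hBc] at hs hsB
        have hs' : min r1 r2 * s0 ≤ s := by nlinarith
        refine ⟨s, hγs.trans hs', hsB.trans hs0X, ?_⟩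
        rcases h with ⟨hUc, hsum⟩ | h
        · obtain ⟨U', hU', h'⟩ := ext _ s p U hsB hU hs' hUc hsum hd
          exact ⟨U', hU', Or.inl h'⟩
        · exact ⟨U, hU.trans hB, Or.inr h⟩
      · obtain ⟨s, hs, hsB, U, hU, h⟩ := h2 hG B (by
          rw [hBc]
          nlinarith)
        rw [hBc] at hs hsB
        have hs' : min r1 r2 * s0 ≤ s := by nlinarith
        refine ⟨s, hγs.trans hs', hsB.trans hs0X, ?_⟩
        rcases h with h | ⟨hUc, hsum⟩
        · exact ⟨U, hU.trans hB, Or.inl h⟩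
        · obtain ⟨U', hU', h'⟩ := ext _ s q U hsB hU hs' hUc hsum hd
          exact ⟨U', hU', Or.inr h'⟩

/-- Rödl's theorem for `P5`. -/
theorem exists_restrictedOn_of_free {c : ℝ} (hc : 0 < c) :
    ∃ r : ℝ, 0 < r ∧ r ≤ 1 ∧ ∀ {V : Type*} {G : SimpleGraph V}, Free P5 G → ∀ X : Finset V,
      ∃ T ⊆ X, r * X.card ≤ T.card ∧ RestrictedOn G T c := by
  obtain ⟨p, hp⟩ := exists_nat_gt (8 / c)
  have hp0 : (0 : ℝ) < p := lt_trans (by positivity) hp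
  have hp8 : 8 < p * c := by rwa [div_lt_iff₀ hc] at hp
  have hp2 : (2 : ℝ) ≤ p + 1 := by
    have : 1 ≤ p := by exact_mod_cast hp0
    exact_mod_cast (by omega : 2 ≤ p + 1)
  obtain ⟨r, hr, hr', h⟩ := exists_sparse_union (p + 1) (p + 1)
  refine ⟨r, hr, by linarith, fun {V G} hG X => ?_⟩
  by_cases hX : 1 ≤ r * X.card
  · obtain ⟨s, hs, -, U, hU, h⟩ := h hG X hX
    have hs0 : (0 : ℝ) < s := by linarith
    have key : ∀ R : SimpleGraph V, U.card = (p + 1) * s →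
        ∑ x ∈ U, ((nbrsIn R x U).card : ℝ) ≤ 2 * (p + 1 : ℕ) * s ^ 2 →
        ∃ T ⊆ X, r * X.card ≤ T.card ∧ SparseOn R T c := by
      intro R hUc hsum
      have hUc' : (U.card : ℝ) = (p + 1) * s := by exact_mod_cast hUc
      obtain ⟨Y, hY, hYc, hYd⟩ := exists_half_sparseOn R U (r := 2 * s) (by positivity)
        (hsum.trans (le_of_eq (by rw [hUc']; push_cast; ring)))
      rw [hUc'] at hYc
      refine ⟨Y, hY.trans hU, ?_, fun y hy => (hYd y hy).trans ?_⟩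
      · nlinarith
      · have : 8 * (s : ℝ) ≤ (p * c) * s := by gcongr
        have h2 : c * ((p + 1) * s / 2) ≤ c * Y.card := by gcongr
        nlinarith [mul_pos hc hs0]
    rcases h with ⟨h, h'⟩ | ⟨h, h'⟩
    · obtain ⟨T, hT, hTc, h⟩ := key G h h'
      exact ⟨T, hT, hTc, Or.inl h⟩
    · obtain ⟨T, hT, hTc, h⟩ := key Gᶜ h h'
      exact ⟨T, hT, hTc, Or.inr h⟩
  · rcases X.eq_empty_or_nonempty with rfl | ⟨v, hv⟩
    · exact ⟨∅, subset_rfl, by simp, Or.inl (by simp [SparseOn])⟩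
    · refine ⟨{v}, by simpa using hv, by simpa using (not_le.1 hX).le, Or.inl ?_⟩
      intro w hw
      rw [mem_singleton] at hw
      subst hw
      simp [nbrsIn, filter_singleton, hc.le]

/-- For any set system there is a subfamily, each member of which covers many elements of its own,
and such that each set of the system covers few elements outside the union of the subfamily. -/
lemma exists_irredundant_subfamily {V : Type*} (E : Finset V) (N : V → Finset V) {τ : ℝ}
    (hτ : 0 ≤ τ) : ∃ K ⊆ E, (∀ a ∈ K, τ ≤ ((N a \ (K.erase a).biUnion N).card : ℝ)) ∧
      ∀ a ∈ E, ((N a \ K.biUnion N).card : ℝ) ≤ τ := by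
  obtain ⟨K, hK, hmax⟩ := exists_max_image E.powerset
    (fun K => ((K.biUnion N).card : ℝ) - τ * K.card) ⟨∅, by simp⟩
  simp only [mem_powerset] at hK hmax
  have hins : ∀ (a : V) (M : Finset V), (((insert a M).biUnion N).card : ℝ) =
      (N a \ M.biUnion N).card + (M.biUnion N).card := by
    intro a M
    rw [biUnion_insert, ← sdiff_union_self_eq_union,
      card_union_of_disjoint sdiff_disjoint]
    push_cast
    rfl
  refine ⟨K, hK, fun a ha => ?_, fun a ha => ?_⟩
  · have h1 := hmax (K.erase a) ((erase_subset _ _).trans hK)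
    have h2 := hins a (K.erase a)
    rw [insert_erase ha] at h2
    have h3 : (K.card : ℝ) = (K.erase a).card + 1 := by
      exact_mod_cast (card_erase_add_one ha).symm
    rw [h3] at h1
    linarith
  · by_cases haK : a ∈ K
    · rw [sdiff_eq_empty_iff_subset.2 (subset_biUnion_of_mem N haK)]
      simpa using hτ
    · have h1 := hmax (insert a K) (insert_subset ha hK)
      have h2 := hins a K
      rw [card_insert_of_notMem haK] at h1
      push_cast at h1
      linarith

lemma adj_of_not_compl_adj {V : Type*} {G : SimpleGraph V} {a b : V} (hne : a ≠ b)
    (h : ¬ Gᶜ.Adj a b) : G.Adj a b := by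
  by_contra h'
  exact h ((SimpleGraph.compl_adj G a b).2 ⟨hne, h'⟩)

lemma not_adj_of_compl_adj {V : Type*} {G : SimpleGraph V} {a b : V} (h : Gᶜ.Adj a b) :
    ¬ G.Adj a b := ((SimpleGraph.compl_adj G a b).1 h).2

/-- Inside the non-neighbourhood of `v`, and for a neighbour `b` of `v`, two neighbours of `b` that
are non-adjacent have comparable sets of non-neighbours among the non-neighbours of `b`. -/
lemma Free.compl_adj_or_of_compl_adj {V : Type*} {G : SimpleGraph V} (hG : Free P5 G)
    {v b w w' a a' : V} (hvb : G.Adj v b) (hvw : Gᶜ.Adj v w)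
    (hva : Gᶜ.Adj v a) (hva' : Gᶜ.Adj v a') (hba : Gᶜ.Adj b a) (hba' : Gᶜ.Adj b a')
    (hbw : G.Adj b w) (hbw' : G.Adj b w') (hww' : Gᶜ.Adj w w') (hwa : Gᶜ.Adj w a)
    (hwa' : Gᶜ.Adj w' a') : Gᶜ.Adj w' a ∨ Gᶜ.Adj w a' := by
  by_contra h
  push Not at h
  obtain ⟨h1, h2⟩ := h
  have n1 : w' ≠ a := by
    rintro rfl
    exact not_adj_of_compl_adj hba hbw'
  have n2 : w ≠ a' := by
    rintro rfl
    exact not_adj_of_compl_adj hba' hbw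
  have e1 : G.Adj w' a := adj_of_not_compl_adj n1 h1
  have e2 : G.Adj w a' := adj_of_not_compl_adj n2 h2
  by_cases haa : Gᶜ.Adj a a'
  · exact hG.false_of_path e1.symm hbw'.symm hbw e2 (not_adj_of_compl_adj hba.symm)
      (not_adj_of_compl_adj hwa.symm) (not_adj_of_compl_adj haa)
      (not_adj_of_compl_adj hww'.symm) (not_adj_of_compl_adj hwa') (not_adj_of_compl_adj hba')
  · have hne : a ≠ a' := by
      rintro rfl
      exact h1 hwa'
    have e3 : G.Adj a a' := adj_of_not_compl_adj hne haa
    exact hG.false_of_path hvb hbw e2 e3.symm (not_adj_of_compl_adj hvw)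
      (not_adj_of_compl_adj hva') (not_adj_of_compl_adj hva) (not_adj_of_compl_adj hba')
      (not_adj_of_compl_adj hba) (not_adj_of_compl_adj hwa)

/-- The second non-neighbourhood of `b` in `A` is, up to the neighbourhoods of a few vertices,
either split into many pairwise complete sets or of small average degree in the complement. -/
lemma Free.exists_family_and_sparse_remainder {V : Type*} {G : SimpleGraph V} (hG : Free P5 G)
    {v b : V} {A : Finset V} (hvb : G.Adj v b) (hvA : ∀ a ∈ A, Gᶜ.Adj v a) {τ D : ℝ} (hτ : 0 < τ)
    (hD : ∀ a ∈ A, ((nbrsIn Gᶜ a A).card : ℝ) ≤ D) {R : Finset V}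
    (hR : R = A.filter fun w => ¬ Gᶜ.Adj b w ∧ ∃ a ∈ nbrsIn Gᶜ b A, Gᶜ.Adj a w) :
    ∃ 𝓕 : Finset (Finset V), (∀ Y ∈ 𝓕, Y ⊆ A ∧ τ ≤ Y.card) ∧
      (𝓕 : Set (Finset V)).Pairwise (CompletePair G) ∧ ∃ R' ⊆ R,
        (R.card : ℝ) ≤ R'.card + 𝓕.card * D ∧
        ∑ w ∈ R', ((nbrsIn Gᶜ w R').card : ℝ) ≤ 2 * τ * R'.card := by
  set E := nbrsIn Gᶜ b A with hE
  let N : V → Finset V := fun a => A.filter fun w => ¬ Gᶜ.Adj b w ∧ Gᶜ.Adj a w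
  obtain ⟨K, hKE, hK1, hK2⟩ := exists_irredundant_subfamily E N hτ.le
  have hEA : E ⊆ A := nbrsIn_subset _ _ _
  have hbA : ∀ w ∈ A, b ≠ w := by
    rintro w hw rfl
    exact not_adj_of_compl_adj (hvA _ hw) hvb
  have hcomp : ∀ w ∈ A, ∀ w' ∈ A, ¬ Gᶜ.Adj b w → ¬ Gᶜ.Adj b w' → Gᶜ.Adj w w' →
      ∀ a ∈ E, ∀ a' ∈ E, Gᶜ.Adj w a → Gᶜ.Adj w' a' → Gᶜ.Adj w' a ∨ Gᶜ.Adj w a' := by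
    intro w hw w' hw' hbw hbw' hww' a ha a' ha' hwa hwa'
    exact hG.compl_adj_or_of_compl_adj hvb (hvA w hw) (hvA a (hEA ha)) (hvA a' (hEA ha'))
      (mem_nbrsIn.1 ha).2 (mem_nbrsIn.1 ha').2 (adj_of_not_compl_adj (hbA w hw) hbw)
      (adj_of_not_compl_adj (hbA w' hw') hbw') hww' hwa hwa'
  let P : V → Finset V := fun a => N a \ (K.erase a).biUnion N
  have hPne : ∀ a ∈ K, (P a).Nonempty := fun a ha => by
    rw [← card_pos, ← Nat.cast_pos (α := ℝ)]
    exact hτ.trans_le (hK1 a ha)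
  have hPcp : ∀ a ∈ K, ∀ a' ∈ K, a ≠ a' → CompletePair G (P a) (P a') := by
    intro a ha a' ha' hne w hw w' hw'
    simp only [P, N, mem_sdiff, mem_filter, mem_biUnion, mem_erase, not_exists, not_and] at hw hw'
    obtain ⟨⟨hwA, hbw, haw⟩, hw2⟩ := hw
    obtain ⟨⟨hwA', hbw', haw'⟩, hw2'⟩ := hw'
    have h1 := hw2 a' ⟨hne.symm, ha'⟩ hwA hbw
    have h2 := hw2' a ⟨hne, ha⟩ hwA' hbw'
    refine adj_of_not_compl_adj ?_ fun hww' => ?_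
    · rintro rfl
      exact h1 haw'
    · rcases hcomp w hwA w' hwA' hbw hbw' hww' a (hKE ha) a' (hKE ha') haw.symm haw'.symm with
        h | h
      · exact h2 h.symm
      · exact h1 h.symm
  have hPinj : Set.InjOn P K := by
    intro a ha a' ha' h
    by_contra hne
    obtain ⟨w, hw⟩ := hPne a ha
    exact disjoint_left.1 (hPcp a ha a' ha' hne).disjoint hw (h ▸ hw)
  refine ⟨K.image P, ?_, ?_, R \ K.biUnion N, sdiff_subset, ?_, ?_⟩
  · intro Y hY
    obtain ⟨a, ha, rfl⟩ := mem_image.1 hY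
    exact ⟨sdiff_subset.trans (filter_subset _ _), hK1 a ha⟩
  · intro Y hY Y' hY' hne
    simp only [coe_image, Set.mem_image, mem_coe] at hY hY'
    obtain ⟨a, ha, rfl⟩ := hY
    obtain ⟨a', ha', rfl⟩ := hY'
    exact hPcp a ha a' ha' fun h => hne (by rw [h])
  · rw [card_image_of_injOn hPinj]
    have h1 : R ⊆ (R \ K.biUnion N) ∪ K.biUnion N := by
      rw [sdiff_union_self_eq_union]
      exact subset_union_left
    have h2 : (R.card : ℝ) ≤ (R \ K.biUnion N).card + (K.biUnion N).card := by
      exact_mod_cast (card_le_card h1).trans (card_union_le _ _)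
    have h3 : ((K.biUnion N).card : ℝ) ≤ ∑ a ∈ K, ((N a).card : ℝ) := by
      exact_mod_cast card_biUnion_le
    have h4 : ∑ a ∈ K, ((N a).card : ℝ) ≤ ∑ a ∈ K, D := by
      refine sum_le_sum fun a ha => le_trans ?_ (hD a (hEA (hKE ha)))
      refine Nat.cast_le.2 (card_le_card fun w hw => ?_)
      simp only [N, mem_filter] at hw
      exact mem_nbrsIn.2 ⟨hw.1, hw.2.2⟩
    rw [sum_const, nsmul_eq_mul] at h4
    linarith
  · set R' := R \ K.biUnion N with hR'
    have hmem : ∀ w ∈ R', w ∈ A ∧ ¬ Gᶜ.Adj b w ∧ ∃ a ∈ E, Gᶜ.Adj a w := by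
      intro w hw
      have := (mem_sdiff.1 hw).1
      rw [hR, mem_filter] at this
      exact this
    let Q : V → V → Prop := fun w w' => Gᶜ.Adj w w' ∧ ∀ a ∈ E, Gᶜ.Adj w a → Gᶜ.Adj w' a
    have h1 : ∀ w ∈ R', ((nbrsIn Gᶜ w R').card : ℝ) ≤
        (R'.filter fun w' => Q w w').card + (R'.filter fun w' => Q w' w).card := by
      intro w hw
      have : nbrsIn Gᶜ w R' ⊆ (R'.filter fun w' => Q w w') ∪ R'.filter fun w' => Q w' w := by
        intro w' hw'
        obtain ⟨hw', hww'⟩ := mem_nbrsIn.1 hw'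
        rw [mem_union, mem_filter, mem_filter]
        by_contra hcon
        push Not at hcon
        obtain ⟨h2, h3⟩ := hcon
        have h2 := h2 hw'
        have h3 := h3 hw'
        simp only [Q, not_and, not_forall] at h2 h3
        obtain ⟨a, ha, hwa, hwa2⟩ := h2 hww'
        obtain ⟨a', ha', hwa', hwa2'⟩ := h3 hww'.symm
        rcases hcomp w (hmem w hw).1 w' (hmem w' hw').1 (hmem w hw).2.1 (hmem w' hw').2.1 hww'
          a ha a' ha' hwa hwa' with h | h
        · exact hwa2 h
        · exact hwa2' h
      exact_mod_cast (card_le_card this).trans (card_union_le _ _)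
    have h2 : ∀ w ∈ R', ((R'.filter fun w' => Q w w').card : ℝ) ≤ τ := by
      intro w hw
      obtain ⟨hwA, hbw, a, ha, haw⟩ := hmem w hw
      refine le_trans (Nat.cast_le.2 (card_le_card fun w' hw' => ?_)) (hK2 a ha)
      obtain ⟨hw', -, hQ⟩ := mem_filter.1 hw'
      refine mem_sdiff.2 ⟨mem_filter.2 ⟨(hmem w' hw').1, (hmem w' hw').2.1, ?_⟩,
        (mem_sdiff.1 hw').2⟩
      exact (hQ a ha haw.symm).symm
    have h3 : ∑ w ∈ R', ((R'.filter fun w' => Q w' w).card : ℝ) =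
        ∑ w ∈ R', ((R'.filter fun w' => Q w w').card : ℝ) := by
      exact_mod_cast (sum_card_bipartiteAbove_eq_sum_card_bipartiteBelow (s := R') (t := R') Q).symm
    have h4 := sum_le_sum h1
    rw [sum_add_distrib, h3] at h4
    have h5 := sum_le_sum h2
    rw [sum_const, nsmul_eq_mul] at h5
    linarith

/-- The members of `B` that have a non-neighbour in `X`. -/
noncomputable def touching {V : Type*} (G : SimpleGraph V) (B X : Finset V) : Finset V :=
  B.filter fun b => ∃ a ∈ X, Gᶜ.Adj b a

lemma touching_mono {V : Type*} (G : SimpleGraph V) (B : Finset V) {X Y : Finset V} (h : X ⊆ Y) :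
    touching G B X ⊆ touching G B Y := by
  intro b hb
  obtain ⟨hb, a, ha, hba⟩ := mem_filter.1 hb
  exact mem_filter.2 ⟨hb, a, h ha, hba⟩

/-- The sparsification step in the non-neighbourhood of a vertex `v`. -/
lemma Free.exists_family_or_sparser_or_untouched {V : Type*} {G : SimpleGraph V}
    (hG : Free P5 G) {v : V} {A B : Finset V} (hA : A.Nonempty) (hvA : ∀ a ∈ A, Gᶜ.Adj v a)
    (hvB : ∀ b ∈ B, G.Adj v b) {u ϑ : ℝ} (hu0 : 0 < u) (hu : u ≤ 1 / 8)
    (hsp : SparseOn Gᶜ A (u ^ 4)) (hϑ0 : 0 < ϑ) (hϑ : ((touching G B A).card : ℝ) ≤ ϑ)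
    (hAB : ∀ a ∈ A, ((nbrsIn Gᶜ a B).card : ℝ) ≤ 2 * u ^ 3 * ϑ) :
    (∃ 𝓕 : Finset (Finset V), u⁻¹ ≤ 𝓕.card ∧ (∀ Y ∈ 𝓕, Y ⊆ A ∧ u ^ 40 * A.card ≤ Y.card) ∧
      (𝓕 : Set (Finset V)).Pairwise (CompletePair G)) ∨
    (∃ A' ⊆ A, u ^ 4 * A.card ≤ A'.card ∧ SparseOn Gᶜ A' (u ^ 32)) ∨
    ∃ Y ⊆ A, u ^ 33 * A.card ≤ Y.card ∧ ((touching G B Y).card : ℝ) ≤ u ^ 2 * ϑ := by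
  have hn : (0 : ℝ) < A.card := by exact_mod_cast hA.card_pos
  set n : ℝ := (A.card : ℝ) with hndef
  have hu1 : u ≤ 1 := by linarith
  let R : V → Finset V := fun b =>
    A.filter fun w => ¬ Gᶜ.Adj b w ∧ ∃ a ∈ nbrsIn Gᶜ b A, Gᶜ.Adj a w
  by_cases hlarge : ∃ b ∈ B, 2 * u ^ 3 * n < ((R b).card : ℝ)
  · obtain ⟨b, hb, hRb⟩ := hlarge
    obtain ⟨𝓕, h1, h2, R', hR', h3, h4⟩ := hG.exists_family_and_sparse_remainder (hvB b hb) hvA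
      (τ := u ^ 40 * n) (by positivity) hsp (R := R b) rfl
    by_cases h𝓕 : u⁻¹ ≤ 𝓕.card
    · exact Or.inl ⟨𝓕, h𝓕, h1, h2⟩
    · right
      left
      have h5 : (𝓕.card : ℝ) * (u ^ 4 * n) ≤ u ^ 3 * n := by
        calc (𝓕.card : ℝ) * (u ^ 4 * n) ≤ u⁻¹ * (u ^ 4 * n) := by
              gcongr
              exact (not_le.1 h𝓕).le
          _ = u ^ 3 * n := by field_simp
      have h6 : u ^ 3 * n ≤ R'.card := by linarith
      obtain ⟨Y, hY, hYc, hYd⟩ := exists_half_sparseOn Gᶜ R' (r := 2 * (u ^ 40 * n))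
        (by positivity) h4
      have h7 : u ^ 4 * n ≤ Y.card := by
        have : u * (u ^ 3 * n) ≤ 1 / 2 * (u ^ 3 * n) := by gcongr; linarith
        linarith
      refine ⟨Y, hY.trans (hR'.trans (filter_subset _ _)), h7, fun y hy => (hYd y hy).trans ?_⟩
      calc 2 * (2 * (u ^ 40 * n)) = (4 * u ^ 4) * (u ^ 32 * (u ^ 4 * n)) := by ring
        _ ≤ 1 * (u ^ 32 * Y.card) := by
            gcongr
            calc 4 * u ^ 4 ≤ 4 * (1 / 8) ^ 4 := by gcongr
              _ ≤ 1 := by norm_num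
        _ = u ^ 32 * Y.card := one_mul _
  · right
    push Not at hlarge
    let t : V → Finset V := fun x => B.filter fun b => ∃ a ∈ nbrsIn Gᶜ b A, Gᶜ.Adj a x
    have hsum : ∑ x ∈ A, ((t x).card : ℝ) ≤ 4 * u ^ 3 * ϑ * A.card := by
      have h1 : ∑ x ∈ A, ((t x).card : ℝ) =
          ∑ b ∈ B, ((A.filter fun x => ∃ a ∈ nbrsIn Gᶜ b A, Gᶜ.Adj a x).card : ℝ) := by
        exact_mod_cast sum_card_bipartiteAbove_eq_sum_card_bipartiteBelow (s := A) (t := B)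
          fun x b => ∃ a ∈ nbrsIn Gᶜ b A, Gᶜ.Adj a x
      have h2 : ∀ b ∈ B, ((A.filter fun x => ∃ a ∈ nbrsIn Gᶜ b A, Gᶜ.Adj a x).card : ℝ) ≤
          (nbrsIn Gᶜ b A).card + if b ∈ touching G B A then 2 * u ^ 3 * n else 0 := by
        intro b hb
        have h3 : (A.filter fun x => ∃ a ∈ nbrsIn Gᶜ b A, Gᶜ.Adj a x) ⊆
            nbrsIn Gᶜ b A ∪ R b := by
          intro x hx
          obtain ⟨hxA, hx⟩ := mem_filter.1 hx
          by_cases hbx : Gᶜ.Adj b x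
          · exact mem_union_left _ (mem_nbrsIn.2 ⟨hxA, hbx⟩)
          · exact mem_union_right _ (mem_filter.2 ⟨hxA, hbx, hx⟩)
        have h4 : ((A.filter fun x => ∃ a ∈ nbrsIn Gᶜ b A, Gᶜ.Adj a x).card : ℝ) ≤
            (nbrsIn Gᶜ b A).card + (R b).card := by
          exact_mod_cast (card_le_card h3).trans (card_union_le _ _)
        split_ifs with hbt
        · linarith [hlarge b hb]
        · have : R b = ∅ := by
            refine filter_eq_empty_iff.2 fun w _ h => hbt ?_
            obtain ⟨-, a, ha, -⟩ := h
            exact mem_filter.2 ⟨hb, a, mem_nbrsIn.1 ha⟩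
          rw [this, card_empty, Nat.cast_zero] at h4
          exact h4
      have h5 : ∑ b ∈ B, ((nbrsIn Gᶜ b A).card : ℝ) ≤ 2 * u ^ 3 * ϑ * n := by
        have : ∑ b ∈ B, ((nbrsIn Gᶜ b A).card : ℝ) = ∑ a ∈ A, ((nbrsIn Gᶜ a B).card : ℝ) := by
          exact_mod_cast sum_card_nbrsIn_comm Gᶜ B A
        rw [this]
        refine (sum_le_sum hAB).trans (le_of_eq ?_)
        rw [sum_const, nsmul_eq_mul, mul_comm]
      have h6 : ∑ b ∈ B, (if b ∈ touching G B A then 2 * u ^ 3 * n else 0) ≤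
          2 * u ^ 3 * ϑ * n := by
        have : B.filter (· ∈ touching G B A) = touching G B A :=
          filter_mem_eq_inter.trans (inter_eq_right.2 (filter_subset _ _))
        rw [← sum_filter, sum_const, nsmul_eq_mul, this]
        have : ((touching G B A).card : ℝ) * (2 * u ^ 3 * n) ≤ ϑ * (2 * u ^ 3 * n) := by
          gcongr
        linarith
      rw [h1]
      refine (sum_le_sum h2).trans ?_
      rw [sum_add_distrib]
      linarith
    have hhalf := card_half_le_card_filter A _ (fun x _ => Nat.cast_nonneg _) (by positivity) hsum
    set A1 := A.filter fun x => ((t x).card : ℝ) ≤ 2 * (4 * u ^ 3 * ϑ) with hA1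
    have hA1A : A1 ⊆ A := filter_subset _ _
    by_cases hs : SparseOn Gᶜ A1 (u ^ 32)
    · left
      refine ⟨A1, hA1A, le_trans ?_ hhalf, hs⟩
      have : u ^ 4 ≤ 1 / 2 := by
        calc u ^ 4 ≤ (1 / 8) ^ 4 := by gcongr
          _ ≤ 1 / 2 := by norm_num
      have := mul_le_mul_of_nonneg_right this hn.le
      linarith
    · right
      simp only [SparseOn, not_forall, not_le] at hs
      obtain ⟨x, hx, hxY⟩ := hs
      refine ⟨nbrsIn Gᶜ x A1, (nbrsIn_subset _ _ _).trans hA1A, le_trans ?_ hxY.le, ?_⟩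
      · calc u ^ 33 * n = u ^ 32 * (u * n) := by ring
          _ ≤ u ^ 32 * A1.card := by
              gcongr
              have := mul_le_mul_of_nonneg_right hu hn.le
              linarith
      · have h1 : touching G B (nbrsIn Gᶜ x A1) ⊆ t x := by
          intro b hb
          obtain ⟨hb, a, ha, hba⟩ := mem_filter.1 hb
          obtain ⟨ha, hxa⟩ := mem_nbrsIn.1 ha
          exact mem_filter.2 ⟨hb, a, mem_nbrsIn.2 ⟨hA1A ha, hba⟩, hxa.symm⟩
        have h2 : ((touching G B (nbrsIn Gᶜ x A1)).card : ℝ) ≤ (t x).card := by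
          exact_mod_cast card_le_card h1
        have h3 := (mem_filter.1 hx).2
        have h4 : 2 * (4 * u ^ 3 * ϑ) ≤ u ^ 2 * ϑ := by
          calc 2 * (4 * u ^ 3 * ϑ) = (8 * u) * (u ^ 2 * ϑ) := by ring
            _ ≤ 1 * (u ^ 2 * ϑ) := by
                gcongr
                linarith
            _ = u ^ 2 * ϑ := one_mul _
        linarith

lemma SparseOn.mono {V : Type*} {G : SimpleGraph V} {S : Finset V} {x y : ℝ}
    (h : SparseOn G S x) (hxy : x ≤ y) : SparseOn G S y :=
  fun v hv => (h v hv).trans (by gcongr)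

/-- In a set `P` that is extremal both for pure families and for the number of touching vertices,
a restricted subset contains a much sparser one. -/
lemma Free.exists_sparser_of_extremal {V : Type*} {G : SimpleGraph V} (hG : Free P5 G) {c : ℝ}
    (hc0 : 0 < c) (hc : c ≤ 1 / 24) {t d E : ℕ} (ht : 1 ≤ t) (hE1 : 40 + 4 * d < E)
    (hE2 : 1 < 2 ^ E * c ^ (4 * d + 1)) {v : V} {P B : Finset V} (hvP : ∀ a ∈ P, Gᶜ.Adj v a)
    (hvB : ∀ b ∈ B, G.Adj v b) {ϑ φ : ℝ} (hϑ0 : 0 < ϑ) (hϑ : ((touching G B P).card : ℝ) ≤ ϑ)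
    (hPB : ∀ a ∈ P, ((nbrsIn Gᶜ a B).card : ℝ) ≤ 2 * (c ^ t) ^ 3 * ϑ)
    (hφ : φ ≤ (c ^ t) ^ (4 * d + 44)) (hφP : 1 ≤ φ * P.card)
    (T1 : ∀ X ⊆ P, φ * P.card ≤ X.card →
      (X.card : ℝ) * ϑ ^ E ≤ P.card * ((touching G B X).card : ℝ) ^ E)
    (T2 : ∀ R, R = G ∨ R = Gᶜ → ∀ 𝓕 : Finset (Finset V),
      (𝓕 : Set (Finset V)).Pairwise (CompletePair R) → ∀ β : ℝ, 0 < β →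
      (∀ Y ∈ 𝓕, Y ⊆ P ∧ φ * P.card ≤ Y.card ∧ β * P.card ≤ Y.card) →
      (𝓕.card : ℝ) ^ E * β ≤ 1)
    {A : Finset V} (hA : A ⊆ P) (hAc : (c ^ t) ^ (4 * d) * P.card ≤ A.card)
    (hr : RestrictedOn G A ((c ^ t) ^ 4)) :
    ∃ A' ⊆ A, (c ^ t) ^ 4 * A.card ≤ A'.card ∧ SparseOn Gᶜ A' ((c ^ t) ^ 32) := by
  have hu0 : 0 < c ^ t := by positivity
  have huc : c ^ t ≤ c := by
    calc c ^ t ≤ c ^ 1 := pow_le_pow_of_le_one hc0.le (by linarith) ht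
      _ = c := pow_one c
  set u := c ^ t with hu
  have hu1 : u < 1 := by linarith
  have hP0 : (0 : ℝ) ≤ P.card := Nat.cast_nonneg _
  have hP : (0 : ℝ) < P.card := by
    rcases hP0.lt_or_eq with h | h
    · exact h
    · rw [← h, mul_zero] at hφP
      linarith
  -- relative sizes in `A` give relative sizes in `P`
  have rel : ∀ (k : ℕ), ∀ {Y : Finset V}, u ^ k * A.card ≤ Y.card →
      u ^ (4 * d + k) * P.card ≤ Y.card := by
    intro k Y hY
    refine le_trans ?_ hY
    rw [add_comm, pow_add, mul_assoc]
    gcongr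
  have big : ∀ (k : ℕ), k ≤ 44 → ∀ {Y : Finset V}, u ^ k * A.card ≤ Y.card →
      φ * P.card ≤ Y.card := by
    intro k hk Y hY
    refine le_trans ?_ (rel k hY)
    refine mul_le_mul_of_nonneg_right (hφ.trans ?_) hP0
    exact pow_le_pow_of_le_one hu0.le hu1.le (by omega)
  have hA1 : 1 ≤ u ^ 4 * A.card := by
    refine hφP.trans ?_
    calc φ * P.card ≤ u ^ (4 * d + 44) * P.card := by gcongr
      _ ≤ u ^ (4 + 4 * d) * P.card := by
          refine mul_le_mul_of_nonneg_right ?_ hP0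
          exact pow_le_pow_of_le_one hu0.le hu1.le (by omega)
      _ = u ^ 4 * (u ^ (4 * d) * P.card) := by rw [pow_add, mul_assoc]
      _ ≤ u ^ 4 * A.card := by gcongr
  have hAne : A.Nonempty := by
    rw [nonempty_iff_ne_empty]
    rintro rfl
    simp at hA1
    linarith
  have hAP : (A.card : ℝ) ≤ P.card := by exact_mod_cast card_le_card hA
  rcases hr with hr | hr
  · exfalso
    have hct : u ^ 4 ≤ c ^ (t + 1) := by
      rw [hu, ← pow_mul]
      exact pow_le_pow_of_le_one hc0.le (by linarith) (by omega)
    obtain ⟨𝓕, h1, h2, h3⟩ := hG.exists_family_of_sparse hc0 hc t A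
      (hA1.trans (by gcongr)) fun v hv => (hr v hv).trans (by gcongr)
    have h4 := T2 Gᶜ (Or.inr rfl) 𝓕 h3 (u ^ (4 * d + 1)) (by positivity) fun Y hY =>
      have hY' : u ^ 1 * A.card ≤ Y.card := by
        rw [pow_one]
        exact (h2 Y hY).2
      ⟨(h2 Y hY).1.trans hA, big 1 (by omega) hY', rel 1 hY'⟩
    have h5 : (2 : ℝ) ^ t ≤ 𝓕.card := by exact_mod_cast h1
    have h6 : ((2 : ℝ) ^ t) ^ E * u ^ (4 * d + 1) ≤ 1 := by
      refine le_trans ?_ h4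
      gcongr
    have h7 : ((2 : ℝ) ^ t) ^ E * u ^ (4 * d + 1) = (2 ^ E * c ^ (4 * d + 1)) ^ t := by
      rw [hu, mul_pow, ← pow_mul, ← pow_mul, ← pow_mul, ← pow_mul, mul_comm t E,
        mul_comm t (4 * d + 1)]
    have h8 := one_lt_pow₀ hE2 (show t ≠ 0 by omega)
    linarith
  · rcases hG.exists_family_or_sparser_or_untouched hAne (fun a ha => hvP a (hA ha)) hvB hu0
      (by linarith) hr hϑ0 (le_trans (Nat.cast_le.2 (card_le_card (touching_mono G B hA))) hϑ)
      (fun a ha => hPB a (hA ha)) with ⟨𝓕, h1, h2, h3⟩ | h | ⟨Y, hY, hYc, hYt⟩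
    · exfalso
      have h4 := T2 G (Or.inl rfl) 𝓕 h3 (u ^ (4 * d + 40)) (by positivity) fun Y hY =>
        ⟨(h2 Y hY).1.trans hA, big 40 (by omega) (h2 Y hY).2, rel 40 (h2 Y hY).2⟩
      have h5 : (u⁻¹) ^ E * u ^ (4 * d + 40) ≤ 1 := by
        refine le_trans ?_ h4
        gcongr
      rw [inv_pow, inv_mul_le_iff₀ (by positivity), mul_one] at h5
      have h6 := pow_lt_pow_right_of_lt_one₀ hu0 hu1 (show 4 * d + 40 < E by omega)
      linarith
    · exact h
    · exfalso
      have h1 := T1 Y (hY.trans hA) (big 33 (by omega) hYc)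
      have h2 : u ^ (4 * d + 33) * P.card * ϑ ^ E ≤ P.card * (u ^ 2 * ϑ) ^ E := by
        calc u ^ (4 * d + 33) * P.card * ϑ ^ E ≤ Y.card * ϑ ^ E := by
              gcongr
              exact rel 33 hYc
          _ ≤ P.card * ((touching G B Y).card : ℝ) ^ E := h1
          _ ≤ P.card * (u ^ 2 * ϑ) ^ E := by gcongr
      have h3 : u ^ (4 * d + 33) ≤ u ^ (2 * E) := by
        have h4 : 0 < (P.card : ℝ) * ϑ ^ E := by positivity
        rw [mul_pow, ← pow_mul u 2 E] at h2
        refine le_of_mul_le_mul_right ?_ h4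
        linarith
      have h4 := pow_lt_pow_right_of_lt_one₀ hu0 hu1 (show 4 * d + 33 < 2 * E by omega)
      linarith

/-- Iterating the sparsification step inside an extremal set. -/
lemma Free.exists_sparse_of_extremal {V : Type*} {G : SimpleGraph V} (hG : Free P5 G) {c : ℝ}
    (hc0 : 0 < c) (hc : c ≤ 1 / 24) {d E : ℕ} (hd : 1 ≤ d) (hE1 : 40 + 4 * d < E)
    (hE2 : 1 < 2 ^ E * c ^ (4 * d + 1)) {v : V} {P B : Finset V} (hvP : ∀ a ∈ P, Gᶜ.Adj v a)
    (hvB : ∀ b ∈ B, G.Adj v b) {ϑ : ℝ} (hϑ0 : 0 < ϑ) (hϑ : ((touching G B P).card : ℝ) ≤ ϑ) {i : ℕ}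
    {u : ℝ} (hui : u = c ^ 2 ^ i)
    (hPB : ∀ a ∈ P, ((nbrsIn Gᶜ a B).card : ℝ) ≤ 2 * u ^ 3 * ϑ)
    (hφP : 1 ≤ u ^ (4 * d + 44) * P.card)
    (hrodl : ∃ A ⊆ P, c ^ (4 * d) * P.card ≤ A.card ∧ RestrictedOn G A (c ^ 4))
    (T1 : ∀ X ⊆ P, u ^ (4 * d + 44) * P.card ≤ X.card →
      (X.card : ℝ) * ϑ ^ E ≤ P.card * ((touching G B X).card : ℝ) ^ E)
    (T2 : ∀ R, R = G ∨ R = Gᶜ → ∀ 𝓕 : Finset (Finset V),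
      (𝓕 : Set (Finset V)).Pairwise (CompletePair R) → ∀ β : ℝ, 0 < β →
      (∀ Y ∈ 𝓕, Y ⊆ P ∧ u ^ (4 * d + 44) * P.card ≤ Y.card ∧ β * P.card ≤ Y.card) →
      (𝓕.card : ℝ) ^ E * β ≤ 1) :
    ∃ A ⊆ P, u ^ (4 * d + 44) * P.card ≤ A.card ∧ SparseOn Gᶜ A (u ^ 32) := by
  have hc1 : c ≤ 1 := by linarith
  have hpos : ∀ j : ℕ, 0 < c ^ 2 ^ j := fun j => by positivity
  have hle1 : ∀ j : ℕ, c ^ 2 ^ j ≤ 1 := fun j => pow_le_one₀ hc0.le hc1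
  have step : ∀ j ≤ i, ∀ A ⊆ P, (c ^ 2 ^ j) ^ (4 * d) * P.card ≤ A.card →
      RestrictedOn G A ((c ^ 2 ^ j) ^ 4) →
      ∃ A' ⊆ P, (c ^ 2 ^ j) ^ (4 * d + 4) * P.card ≤ A'.card ∧
        SparseOn Gᶜ A' ((c ^ 2 ^ j) ^ 32) := by
    intro j hj A hA hAc hr
    have huj : u ≤ c ^ 2 ^ j := by
      rw [hui]
      exact pow_le_pow_of_le_one hc0.le hc1 (Nat.pow_le_pow_right (by norm_num) hj)
    have hu0 : 0 ≤ u := hui ▸ (hpos i).le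
    obtain ⟨A', hA', h1, h2⟩ := hG.exists_sparser_of_extremal hc0 hc Nat.one_le_two_pow hE1 hE2 hvP
      hvB hϑ0 hϑ (fun a ha => (hPB a ha).trans (by gcongr)) (by gcongr) hφP T1 T2 hA hAc hr
    refine ⟨A', hA'.trans hA, le_trans ?_ h1, h2⟩
    rw [add_comm, pow_add, mul_assoc]
    gcongr
  have main : ∀ j ≤ i, ∃ A ⊆ P, (c ^ 2 ^ j) ^ (4 * d) * P.card ≤ A.card ∧
      RestrictedOn G A ((c ^ 2 ^ j) ^ 4) := by
    intro j
    induction j with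
    | zero =>
      intro _
      simpa using hrodl
    | succ j ih =>
      intro hj
      obtain ⟨A, hA, hAc, hr⟩ := ih (by omega)
      obtain ⟨A', hA', hAc', hr'⟩ := step j (by omega) A hA hAc hr
      have hsq : c ^ 2 ^ (j + 1) = (c ^ 2 ^ j) ^ 2 := by rw [← pow_mul, pow_succ]
      refine ⟨A', hA', le_trans ?_ hAc', Or.inr (hr'.mono ?_)⟩
      · rw [hsq, ← pow_mul (c ^ 2 ^ j)]
        refine mul_le_mul_of_nonneg_right ?_ (Nat.cast_nonneg _)
        exact pow_le_pow_of_le_one (hpos j).le (hle1 j) (by omega)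
      · rw [hsq, ← pow_mul (c ^ 2 ^ j)]
        exact pow_le_pow_of_le_one (hpos j).le (hle1 j) (by omega)
  obtain ⟨A, hA, hAc, hr⟩ := main i le_rfl
  obtain ⟨A', hA', hAc', hr'⟩ := step i le_rfl A hA hAc hr
  rw [← hui] at hAc' hr'
  refine ⟨A', hA', le_trans ?_ hAc', hr'⟩
  refine mul_le_mul_of_nonneg_right ?_ (Nat.cast_nonneg _)
  rw [hui]
  exact pow_le_pow_of_le_one (hpos i).le (hle1 i) (by omega)

/-- The largest number of pairwise `R`-complete subsets of `X` of size at least `w`. -/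
noncomputable def pureCount {V : Type*} (w : ℕ) (R : SimpleGraph V) (X : Finset V) : ℕ :=
  (X.powerset.powerset.filter fun 𝓕 : Finset (Finset V) => (∀ Y ∈ 𝓕, w ≤ Y.card) ∧
    (𝓕 : Set (Finset V)).Pairwise (CompletePair R)).sup Finset.card

lemma card_le_pureCount {V : Type*} {w : ℕ} {R : SimpleGraph V} {X : Finset V}
    {𝓕 : Finset (Finset V)} (h𝓕 : ∀ Y ∈ 𝓕, Y ⊆ X ∧ w ≤ Y.card)
    (hp : (𝓕 : Set (Finset V)).Pairwise (CompletePair R)) : 𝓕.card ≤ pureCount w R X := by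
  refine le_sup (f := card) (mem_filter.2 ⟨mem_powerset.2 fun Y hY => ?_, fun Y hY => ?_, hp⟩)
  · exact mem_powerset.2 (h𝓕 Y hY).1
  · exact (h𝓕 Y hY).2

lemma exists_card_eq_pureCount {V : Type*} (w : ℕ) (R : SimpleGraph V) (X : Finset V) :
    ∃ 𝓕 : Finset (Finset V), (∀ Y ∈ 𝓕, Y ⊆ X ∧ w ≤ Y.card) ∧
      (𝓕 : Set (Finset V)).Pairwise (CompletePair R) ∧ 𝓕.card = pureCount w R X := by
  obtain ⟨𝓕, h𝓕, h⟩ := exists_mem_eq_sup (X.powerset.powerset.filter fun 𝓕 : Finset (Finset V) =>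
    (∀ Y ∈ 𝓕, w ≤ Y.card) ∧ (𝓕 : Set (Finset V)).Pairwise (CompletePair R)) ⟨∅, by simp⟩ card
  obtain ⟨h1, h2, h3⟩ := mem_filter.1 h𝓕
  exact ⟨𝓕, fun Y hY => ⟨mem_powerset.1 (mem_powerset.1 h1 hY), h2 Y hY⟩, h3, h.symm⟩

lemma pureCount_mono {V : Type*} (w : ℕ) (R : SimpleGraph V) {X Y : Finset V} (h : X ⊆ Y) :
    pureCount w R X ≤ pureCount w R Y := by
  obtain ⟨𝓕, h1, h2, h3⟩ := exists_card_eq_pureCount w R X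
  rw [← h3]
  exact card_le_pureCount (fun Z hZ => ⟨(h1 Z hZ).1.trans h, (h1 Z hZ).2⟩) h2

lemma one_le_pureCount {V : Type*} {w : ℕ} (R : SimpleGraph V) {X : Finset V} (h : w ≤ X.card) :
    1 ≤ pureCount w R X :=
  card_le_pureCount (𝓕 := {X}) (by simpa using h) (by simp)

lemma sum_pureCount_le {V : Type*} {w : ℕ} (hw : 1 ≤ w) {R : SimpleGraph V} {X : Finset V}
    {𝓐 : Finset (Finset V)} (h𝓐 : (𝓐 : Set (Finset V)).Pairwise (CompletePair R))
    (hX : ∀ Y ∈ 𝓐, Y ⊆ X) : ∑ Y ∈ 𝓐, pureCount w R Y ≤ pureCount w R X := by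
  choose 𝓕 h1 h2 h3 using exists_card_eq_pureCount w R
  obtain ⟨h4, h5⟩ := pairwise_completePair_biUnion h𝓐 𝓕 (fun Y _ Z hZ => (h1 Y Z hZ).1)
    (fun Y _ Z hZ => card_pos.1 (hw.trans (h1 Y Z hZ).2)) fun Y _ => h2 Y
  simp only [h3] at h5
  rw [← h5]
  refine card_le_pureCount (fun Z hZ => ?_) h4
  obtain ⟨Y, hY, hZ⟩ := mem_biUnion.1 hZ
  exact ⟨(h1 Y Z hZ).1.trans (hX Y hY), (h1 Y Z hZ).2⟩

/-- The product of the counts of pure families in a graph and in its complement. -/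
noncomputable def purity {V : Type*} (w : ℕ) (G : SimpleGraph V) (X : Finset V) : ℕ :=
  pureCount w G X * pureCount w Gᶜ X

lemma purity_mono {V : Type*} (w : ℕ) (G : SimpleGraph V) {X Y : Finset V} (h : X ⊆ Y) :
    purity w G X ≤ purity w G Y :=
  Nat.mul_le_mul (pureCount_mono w G h) (pureCount_mono w Gᶜ h)

lemma one_le_purity {V : Type*} {w : ℕ} (G : SimpleGraph V) {X : Finset V} (h : w ≤ X.card) :
    1 ≤ purity w G X :=
  Nat.mul_pos (one_le_pureCount G h) (one_le_pureCount Gᶜ h)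

lemma card_mul_le_purity {V : Type*} {w : ℕ} (hw : 1 ≤ w) {G R : SimpleGraph V}
    (hR : R = G ∨ R = Gᶜ) {X : Finset V} {𝓐 : Finset (Finset V)}
    (h𝓐 : (𝓐 : Set (Finset V)).Pairwise (CompletePair R)) (hX : ∀ Y ∈ 𝓐, Y ⊆ X) {t : ℕ}
    (ht : ∀ Y ∈ 𝓐, t ≤ purity w G Y) : 𝓐.card * t ≤ purity w G X := by
  have key : ∀ R R' : SimpleGraph V, (𝓐 : Set (Finset V)).Pairwise (CompletePair R) →
      (∀ Y ∈ 𝓐, t ≤ pureCount w R Y * pureCount w R' Y) →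
      𝓐.card * t ≤ pureCount w R X * pureCount w R' X := by
    intro R R' h𝓐 ht
    calc 𝓐.card * t = ∑ Y ∈ 𝓐, t := by simp
      _ ≤ ∑ Y ∈ 𝓐, pureCount w R Y * pureCount w R' X := by
          refine sum_le_sum fun Y hY => (ht Y hY).trans ?_
          exact Nat.mul_le_mul_left _ (pureCount_mono w R' (hX Y hY))
      _ ≤ pureCount w R X * pureCount w R' X := by
          rw [← sum_mul]
          exact Nat.mul_le_mul_right _ (sum_pureCount_le hw h𝓐 hX)
  rcases hR with rfl | rfl
  · exact key _ _ h𝓐 ht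
  · rw [purity, mul_comm (pureCount w G X)]
    exact key _ _ h𝓐 fun Y hY => by
      rw [mul_comm]
      exact ht Y hY

/-- A pure family whose members retain much of the purity of the host is small. -/
lemma card_pow_mul_le_one {V : Type*} {w : ℕ} (hw : 1 ≤ w) {G R : SimpleGraph V}
    (hR : R = G ∨ R = Gᶜ) {X : Finset V} (hXw : w ≤ X.card) {𝓐 : Finset (Finset V)}
    (h𝓐 : (𝓐 : Set (Finset V)).Pairwise (CompletePair R)) (hX : ∀ Y ∈ 𝓐, Y ⊆ X) {E : ℕ}
    (hE : E ≠ 0) {β : ℝ}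
    (h : ∀ Y ∈ 𝓐, β * (purity w G X : ℝ) ^ E ≤ (purity w G Y : ℝ) ^ E) :
    (𝓐.card : ℝ) ^ E * β ≤ 1 := by
  rcases 𝓐.eq_empty_or_nonempty with rfl | hne
  · simp [hE]
  · obtain ⟨Y, hY, hmin⟩ := exists_min_image 𝓐 (purity w G) hne
    have h1 : (𝓐.card : ℝ) * purity w G Y ≤ purity w G X := by
      exact_mod_cast card_mul_le_purity hw hR h𝓐 hX hmin
    have h2 : (0 : ℝ) < purity w G X := by exact_mod_cast one_le_purity G hXw
    have h3 : ((𝓐.card : ℝ) * purity w G Y) ^ E ≤ (purity w G X : ℝ) ^ E := by gcongr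
    have h4 := mul_le_mul_of_nonneg_left (h Y hY) (show (0 : ℝ) ≤ (𝓐.card : ℝ) ^ E by positivity)
    rw [mul_pow] at h3
    refine le_of_mul_le_mul_right ?_ (pow_pos h2 E)
    linarith

/-- Many pairwise complete sets contain a large set that is sparse in the complement. -/
lemma exists_sparseOn_compl_of_pureCount {V : Type*} {w : ℕ} {R : SimpleGraph V} {X : Finset V}
    {ε : ℝ} (hε : 0 < ε) (h : 1 / ε < pureCount w R X) :
    ∃ U ⊆ X, w ≤ U.card ∧ SparseOn Rᶜ U ε := by
  obtain ⟨𝓕, h1, h2, h3⟩ := exists_card_eq_pureCount w R X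
  rw [← h3, div_lt_iff₀ hε] at h
  have htrim : ∀ Y : Finset V, ∃ Z ⊆ Y, Y ∈ 𝓕 → Z.card = w := by
    intro Y
    by_cases hY : Y ∈ 𝓕
    · obtain ⟨Z, hZ, hZc⟩ := exists_subset_card_eq (h1 Y hY).2
      exact ⟨Z, hZ, fun _ => hZc⟩
    · exact ⟨∅, empty_subset _, fun h => absurd h hY⟩
  choose g hg hgc using htrim
  have hcard : (𝓕.biUnion g).card = 𝓕.card * w := by
    rw [card_biUnion fun Y hY Z hZ hYZ => ((h2 hY hZ hYZ).mono (hg Y) (hg Z)).disjoint,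
      sum_congr rfl fun Y hY => hgc Y hY, sum_const, smul_eq_mul]
  have hpos : 0 < 𝓕.card := by
    rw [Nat.pos_iff_ne_zero]
    intro h0
    rw [h0, Nat.cast_zero, zero_mul] at h
    linarith
  refine ⟨𝓕.biUnion g, ?_, ?_, ?_⟩
  · exact biUnion_subset.2 fun Y hY => (hg Y).trans (h1 Y hY).1
  · rw [hcard]
    exact Nat.le_mul_of_pos_left w hpos
  · intro v hv
    obtain ⟨Y, hY, hvY⟩ := mem_biUnion.1 hv
    have hsub : nbrsIn Rᶜ v (𝓕.biUnion g) ⊆ g Y := by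
      intro x hx
      obtain ⟨hx, hvx⟩ := mem_nbrsIn.1 hx
      obtain ⟨Z, hZ, hxZ⟩ := mem_biUnion.1 hx
      by_contra hxY
      have hYZ : Y ≠ Z := by
        rintro rfl
        exact hxY hxZ
      exact not_adj_of_compl_adj hvx (h2 hY hZ hYZ v (hg Y hvY) x (hg Z hxZ))
    have h4 : ((nbrsIn Rᶜ v (𝓕.biUnion g)).card : ℝ) ≤ w := by
      rw [← hgc Y hY]
      exact_mod_cast card_le_card hsub
    rw [hcard]
    push_cast
    nlinarith [(Nat.cast_nonneg w : (0 : ℝ) ≤ w)]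

lemma purity_le_of_forall_not_restrictedOn {V : Type*} {w : ℕ} {G : SimpleGraph V} {X : Finset V}
    {ε : ℝ} (hε : 0 < ε) (h : ∀ U ⊆ X, w ≤ U.card → ¬ RestrictedOn G U ε) :
    (purity w G X : ℝ) ≤ (1 / ε) ^ 2 := by
  have h1 : (pureCount w G X : ℝ) ≤ 1 / ε := by
    by_contra hlt
    obtain ⟨U, hU, hUc, hs⟩ := exists_sparseOn_compl_of_pureCount hε (not_le.1 hlt)
    exact h U hU hUc (Or.inr hs)
  have h2 : (pureCount w Gᶜ X : ℝ) ≤ 1 / ε := by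
    by_contra hlt
    obtain ⟨U, hU, hUc, hs⟩ := exists_sparseOn_compl_of_pureCount hε (not_le.1 hlt)
    rw [compl_compl] at hs
    exact h U hU hUc (Or.inl hs)
  rw [purity, Nat.cast_mul, sq]
  gcongr

/-- The set `S` maximises `|X| / purity X ^ L` over all sets of size at least `w`. -/
def PurityExtremal {V : Type*} (w L : ℕ) (G : SimpleGraph V) (S : Finset V) : Prop :=
  w ≤ S.card ∧ ∀ X : Finset V, w ≤ X.card →
    (X.card : ℝ) * (purity w G S : ℝ) ^ L ≤ S.card * (purity w G X : ℝ) ^ L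

lemma PurityExtremal.mul_le_purity {V : Type*} {w L : ℕ} {G : SimpleGraph V} {S : Finset V}
    (hS : PurityExtremal w L G S) (hw : 1 ≤ w) {X : Finset V} (hX : w ≤ X.card) {β : ℝ}
    (hβ : β * S.card ≤ X.card) : β * (purity w G S : ℝ) ^ L ≤ (purity w G X : ℝ) ^ L := by
  have h1 := hS.2 X hX
  have h2 : (0 : ℝ) < S.card := by exact_mod_cast hw.trans hS.1
  have h3 : (0 : ℝ) ≤ (purity w G S : ℝ) ^ L := by positivity
  refine le_of_mul_le_mul_left ?_ h2
  nlinarith [mul_le_mul_of_nonneg_right hβ h3]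

lemma PurityExtremal.card_pow_mul_le_one {V : Type*} {w L : ℕ} {G R : SimpleGraph V} {S : Finset V}
    (hS : PurityExtremal w L G S) (hw : 1 ≤ w) (hL : L ≠ 0) (hR : R = G ∨ R = Gᶜ)
    {𝓐 : Finset (Finset V)} (h𝓐 : (𝓐 : Set (Finset V)).Pairwise (CompletePair R)) {β : ℝ}
    (hX : ∀ Y ∈ 𝓐, Y ⊆ S ∧ w ≤ Y.card ∧ β * S.card ≤ Y.card) :
    (𝓐.card : ℝ) ^ L * β ≤ 1 :=
  _root_.card_pow_mul_le_one hw hR hS.1 h𝓐 (fun Y hY => (hX Y hY).1) hL fun Y hY =>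
    hS.mul_le_purity hw (hX Y hY).2.1 (hX Y hY).2.2

/-- A set maximising `|X| / (purity X * |touching X|) ^ E` over the large subsets of `A` which touch
much of `B` contains a large set that is very sparse in the complement. -/
lemma Free.exists_sparse_of_touching {V : Type*} {G : SimpleGraph V} (hG : Free P5 G) {c : ℝ}
    (hc0 : 0 < c) (hc : c ≤ 1 / 24) {d E : ℕ} (hd : 1 ≤ d) (hE1 : 40 + 4 * d < E)
    (hE2 : 1 < 2 ^ E * c ^ (4 * d + 1))
    (hrodl : ∀ X : Finset V, ∃ A ⊆ X, c ^ (4 * d) * X.card ≤ A.card ∧ RestrictedOn G A (c ^ 4))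
    {w L M : ℕ} (hw : 1 ≤ w) {S : Finset V} (hS : PurityExtremal w L G S) (hML : M ≤ L)
    (hL : L ≠ 0) {i : ℕ} {u : ℝ} (hui : u = c ^ 2 ^ i) (hwM : w ≤ u ^ M * S.card) {v : V}
    {A B : Finset V} (hAS : A ⊆ S) (hvA : ∀ a ∈ A, Gᶜ.Adj v a) (hvB : ∀ b ∈ B, G.Adj v b)
    (hA : u ^ M * S.card ≤ u ^ (3 * E + 4 * d + 44) * A.card) {q : ℝ} (hq : 0 < q)
    (hBq : (B.card : ℝ) ≤ q)
    (hAB : ∀ a ∈ A, ((nbrsIn Gᶜ a B).card : ℝ) ≤ 2 * u ^ 16 * q)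
    (hθ : ∀ X ⊆ A, u ^ M * S.card ≤ X.card → u ^ 2 * q < (touching G B X).card) :
    ∃ Y ⊆ A, u ^ M * S.card ≤ Y.card ∧ SparseOn Gᶜ Y (u ^ 32) := by
  have hu0 : 0 < u := hui ▸ pow_pos hc0 _
  have hu1 : u ≤ 1 := hui ▸ pow_le_one₀ hc0.le (by linarith)
  have hA' : u ^ M * S.card ≤ A.card :=
    hA.trans (mul_le_of_le_one_left (by positivity) (pow_le_one₀ hu0.le hu1))
  have hbig : ∀ X : Finset V, u ^ M * S.card ≤ X.card → w ≤ X.card := fun X hX => by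
    exact_mod_cast hwM.trans hX
  set g : Finset V → ℝ := fun X => ((purity w G X : ℝ) * (touching G B X).card) ^ E with hg
  obtain ⟨P, hP, hmax⟩ := exists_max_image
    (A.powerset.filter fun X => u ^ M * S.card ≤ X.card) (fun X => (X.card : ℝ) / g X)
    ⟨A, mem_filter.2 ⟨mem_powerset_self _, hA'⟩⟩
  obtain ⟨hPA, hPb⟩ := mem_filter.1 hP
  rw [mem_powerset] at hPA
  have hpur : ∀ X : Finset V, u ^ M * S.card ≤ X.card → (0 : ℝ) < purity w G X := fun X hX => by
    exact_mod_cast one_le_purity G (hbig X hX)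
  have hθ0 : ∀ X ⊆ A, u ^ M * S.card ≤ X.card → (0 : ℝ) < (touching G B X).card := fun X hX h =>
    lt_trans (by positivity) (hθ X hX h)
  have hmax' : ∀ X ⊆ A, u ^ M * S.card ≤ X.card → X.card * g P ≤ P.card * g X := by
    intro X hX h
    have h1 := hmax X (mem_filter.2 ⟨mem_powerset.2 hX, h⟩)
    have h2 : 0 < g X := pow_pos (mul_pos (hpur X h) (hθ0 X hX h)) E
    have h3 : 0 < g P := pow_pos (mul_pos (hpur P hPb) (hθ0 P hPA hPb)) E
    rwa [div_le_div_iff₀ h2 h3] at h1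
  have hpP := hpur P hPb
  have hpS : (0 : ℝ) < purity w G S := by exact_mod_cast one_le_purity G hS.1
  have hPS : u * purity w G S ≤ purity w G P := by
    have h1 := hS.mul_le_purity hw (hbig P hPb) hPb
    have h2 : u ^ L ≤ u ^ M := pow_le_pow_of_le_one hu0.le hu1 hML
    refine le_of_pow_le_pow_left₀ hL hpP.le (le_trans ?_ h1)
    rw [mul_pow]
    gcongr
  have hPA' : u ^ (3 * E) * A.card ≤ P.card := by
    have h1 := hmax' A Subset.rfl hA'
    have h2 : g A ≤ ((purity w G S : ℝ) * q) ^ E := by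
      refine pow_le_pow_left₀ (by positivity) ?_ E
      refine mul_le_mul ?_ (le_trans ?_ hBq) (by positivity) hpS.le
      · exact_mod_cast purity_mono w G hAS
      · exact_mod_cast card_le_card (filter_subset _ _)
    have h3 : u ^ (3 * E) * ((purity w G S : ℝ) * q) ^ E ≤ g P := by
      rw [pow_mul, ← mul_pow]
      refine pow_le_pow_left₀ (by positivity) ?_ E
      calc u ^ 3 * (purity w G S * q) = (u * purity w G S) * (u ^ 2 * q) := by ring
        _ ≤ _ := mul_le_mul hPS (hθ P hPA hPb).le (by positivity) hpP.le
    refine le_of_mul_le_mul_right ?_ (pow_pos (mul_pos hpS hq) E)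
    calc u ^ (3 * E) * A.card * ((purity w G S : ℝ) * q) ^ E
        = A.card * (u ^ (3 * E) * ((purity w G S : ℝ) * q) ^ E) := by ring
      _ ≤ A.card * g P := by gcongr
      _ ≤ P.card * g A := h1
      _ ≤ _ := by gcongr
  have hPbig : u ^ M * S.card ≤ u ^ (4 * d + 44) * P.card := by
    refine hA.trans ?_
    calc u ^ (3 * E + 4 * d + 44) * A.card = u ^ (4 * d + 44) * (u ^ (3 * E) * A.card) := by ring
      _ ≤ _ := by gcongr
  have hϑ0 := hθ0 P hPA hPb
  suffices h : ∃ Y ⊆ P, u ^ (4 * d + 44) * P.card ≤ Y.card ∧ SparseOn Gᶜ Y (u ^ 32) by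
    obtain ⟨Y, hY, hYc, hYs⟩ := h
    exact ⟨Y, hY.trans hPA, hPbig.trans hYc, hYs⟩
  refine hG.exists_sparse_of_extremal hc0 hc hd hE1 hE2 (fun a ha => hvA a (hPA ha)) hvB hϑ0
    le_rfl hui ?_ ?_ (hrodl P) ?_ ?_
  · intro a ha
    refine (hAB a (hPA ha)).trans ?_
    have h1 : u ^ 14 ≤ u ^ 3 := pow_le_pow_of_le_one hu0.le hu1 (by norm_num)
    calc 2 * u ^ 16 * q = 2 * u ^ 14 * (u ^ 2 * q) := by ring
      _ ≤ 2 * u ^ 3 * (touching G B P).card := by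
        have := (hθ P hPA hPb).le
        gcongr
  · refine le_trans ?_ (hwM.trans hPbig)
    exact_mod_cast hw
  · intro X hX hXc
    have h1 := hmax' X (hX.trans hPA) (hPbig.trans hXc)
    simp only [hg, mul_pow] at h1
    have h2 : (purity w G X : ℝ) ≤ purity w G P := by exact_mod_cast purity_mono w G hX
    refine le_of_mul_le_mul_left ?_ (pow_pos hpP E)
    calc (purity w G P : ℝ) ^ E * (X.card * ((touching G B P).card : ℝ) ^ E)
        = X.card * ((purity w G P : ℝ) ^ E * ((touching G B P).card : ℝ) ^ E) := by ring
      _ ≤ _ := h1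
      _ ≤ P.card * ((purity w G P : ℝ) ^ E * ((touching G B X).card : ℝ) ^ E) := by gcongr
      _ = _ := by ring
  · intro R hR 𝓕 h𝓕 β hβ h
    refine card_pow_mul_le_one hw hR (hbig P hPb) h𝓕 (fun Y hY => (h Y hY).1) (by omega) ?_
    intro Y hY
    obtain ⟨hYP, hYc, hYβ⟩ := h Y hY
    have h1 := hmax' Y (hYP.trans hPA) (hPbig.trans hYc)
    simp only [hg, mul_pow] at h1
    have h2 : ((touching G B Y).card : ℝ) ≤ (touching G B P).card := by
      exact_mod_cast card_le_card (touching_mono G B hYP)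
    have hP0 : (0 : ℝ) < P.card := by exact_mod_cast hw.trans (hbig P hPb)
    refine le_of_mul_le_mul_right ?_ (mul_pos hP0 (pow_pos hϑ0 E))
    calc β * (purity w G P : ℝ) ^ E * (P.card * ((touching G B P).card : ℝ) ^ E)
        = (β * P.card) * ((purity w G P : ℝ) ^ E * ((touching G B P).card : ℝ) ^ E) := by ring
      _ ≤ Y.card * ((purity w G P : ℝ) ^ E * ((touching G B P).card : ℝ) ^ E) := by gcongr
      _ ≤ _ := h1
      _ ≤ P.card * ((purity w G Y : ℝ) ^ E * ((touching G B P).card : ℝ) ^ E) := by gcongr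
      _ = _ := by ring

/-- In a set `Q` that is dense in `G`, there is a large set complete to almost all of `Q`, or a set
that is much denser. -/
lemma Free.exists_block_or_sparse {V : Type*} {G : SimpleGraph V} (hG : Free P5 G) {c : ℝ}
    (hc0 : 0 < c) (hc : c ≤ 1 / 24) {d E : ℕ} (hd : 1 ≤ d) (hE1 : 40 + 4 * d < E)
    (hE2 : 1 < 2 ^ E * c ^ (4 * d + 1))
    (hrodl : ∀ X : Finset V, ∃ A ⊆ X, c ^ (4 * d) * X.card ≤ A.card ∧ RestrictedOn G A (c ^ 4))
    {w L K M : ℕ} (hw : 1 ≤ w) {S : Finset V} (hS : PurityExtremal w L G S) (hML : M ≤ L)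
    (hKM : 3 * E + 4 * d + 77 + K ≤ M) {i : ℕ} {u : ℝ} (hui : u = c ^ 2 ^ i)
    (hwM : w ≤ u ^ M * S.card) {T Q : Finset V} (hTS : T ⊆ S) (hTs : SparseOn Gᶜ T (u ^ 16))
    (hTK : u ^ K * S.card ≤ T.card) (hQT : Q ⊆ T) (hQ : (T.card : ℝ) ≤ 2 * Q.card) :
    (∃ Y ⊆ S, u ^ M * S.card ≤ Y.card ∧ SparseOn Gᶜ Y (u ^ 32)) ∨
      ∃ Y ⊆ Q, u ^ M * S.card ≤ Y.card ∧
        ((Q.filter fun b => ¬ ∀ a ∈ Y, G.Adj b a).card : ℝ) ≤ 2 * u ^ 2 * T.card := by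
  have hu0 : 0 < u := hui ▸ pow_pos hc0 _
  have hu24 : u ≤ 1 / 24 := by
    rw [hui]
    exact (pow_le_of_le_one hc0.le (by linarith) (by positivity)).trans hc
  have hu1 : u ≤ 1 := by linarith
  have hS0 : (0 : ℝ) < S.card := by exact_mod_cast hw.trans hS.1
  have hw1 : (1 : ℝ) ≤ w := by exact_mod_cast hw
  have hpow : ∀ {a b : ℕ}, a ≤ b → u ^ b ≤ u ^ a := fun h => pow_le_pow_of_le_one hu0.le hu1 h
  have hT0 : (0 : ℝ) < T.card := lt_of_lt_of_le (by positivity) hTK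
  have hQ0 : (0 : ℝ) < Q.card := by linarith
  have hQu : u * T.card ≤ Q.card := by nlinarith
  rw [or_iff_not_imp_left]
  intro hno
  obtain ⟨v, hvQ, hv⟩ : ∃ v ∈ Q, u ^ 32 * Q.card < (nbrsIn Gᶜ v Q).card := by
    by_contra! hcon
    refine hno ⟨Q, hQT.trans hTS, ?_, hcon⟩
    calc u ^ M * S.card ≤ u ^ (K + 1) * S.card := by
          gcongr ?_ * _
          exact hpow (by omega)
      _ = u * (u ^ K * S.card) := by ring
      _ ≤ u * T.card := by gcongr
      _ ≤ Q.card := hQu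
  set A := nbrsIn Gᶜ v Q with hA
  set B := Q.filter fun b => b ≠ v ∧ ¬ Gᶜ.Adj v b with hB
  have hvA : ∀ a ∈ A, Gᶜ.Adj v a := fun a ha => (mem_nbrsIn.1 ha).2
  have hvB : ∀ b ∈ B, G.Adj v b := fun b hb =>
    adj_of_not_compl_adj (mem_filter.1 hb).2.1.symm (mem_filter.1 hb).2.2
  have hAQ : A ⊆ Q := nbrsIn_subset _ _ _
  have hBQ : B ⊆ Q := filter_subset _ _
  have hnbr : ∀ a ∈ Q, ∀ X ⊆ Q, ((nbrsIn Gᶜ a X).card : ℝ) ≤ u ^ 16 * T.card := by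
    intro a ha X hX
    refine le_trans ?_ (hTs a (hQT ha))
    exact_mod_cast card_le_card (nbrsIn_mono Gᶜ a (hX.trans hQT))
  by_cases hex : ∃ Y ⊆ A, u ^ M * S.card ≤ Y.card ∧
      ((touching G B Y).card : ℝ) ≤ u ^ 2 * Q.card
  · obtain ⟨Y, hYA, hYc, hYθ⟩ := hex
    refine ⟨Y, hYA.trans hAQ, hYc, ?_⟩
    have hsub : (Q.filter fun b => ¬ ∀ a ∈ Y, G.Adj b a) ⊆ insert v (A ∪ touching G B Y) := by
      intro b hb
      obtain ⟨hbQ, hb⟩ := mem_filter.1 hb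
      push Not at hb
      obtain ⟨a, haY, hab⟩ := hb
      rw [mem_insert, mem_union]
      by_cases hbv : b = v
      · exact Or.inl hbv
      · by_cases hbA : Gᶜ.Adj v b
        · exact Or.inr (Or.inl (mem_nbrsIn.2 ⟨hbQ, hbA⟩))
        · refine Or.inr (Or.inr (mem_filter.2 ⟨mem_filter.2 ⟨hbQ, hbv, hbA⟩, a, haY, ?_⟩))
          refine (G.compl_adj b a).2 ⟨?_, hab⟩
          rintro rfl
          exact hbA (hvA _ (hYA haY))
    have h1 : ((Q.filter fun b => ¬ ∀ a ∈ Y, G.Adj b a).card : ℝ) ≤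
        A.card + (touching G B Y).card + 1 := by
      exact_mod_cast (card_le_card hsub).trans
        ((card_insert_le _ _).trans (Nat.add_le_add_right (card_union_le _ _) 1))
    have h2 : (1 : ℝ) ≤ u ^ 16 * T.card := by
      refine hw1.trans (hwM.trans ?_)
      calc u ^ M * S.card ≤ u ^ (16 + K) * S.card := by
            gcongr ?_ * _
            exact hpow (by omega)
        _ = u ^ 16 * (u ^ K * S.card) := by ring
        _ ≤ _ := by gcongr
    have h3 := hnbr v hvQ Q Subset.rfl
    have h4 : (Q.card : ℝ) ≤ T.card := by exact_mod_cast card_le_card hQT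
    have h5 : u ^ 16 ≤ u ^ 2 * (1 / 2) := by
      calc u ^ 16 ≤ u ^ 3 := hpow (by norm_num)
        _ = u ^ 2 * u := by ring
        _ ≤ u ^ 2 * (1 / 2) := by
          gcongr
          linarith
    nlinarith [mul_le_mul_of_nonneg_right h5 hT0.le,
      mul_le_mul_of_nonneg_left h4 (sq_nonneg u)]
  · push Not at hex
    refine absurd ?_ hno
    have hAS := (hAQ.trans hQT).trans hTS
    suffices h : ∃ Y ⊆ A, u ^ M * S.card ≤ Y.card ∧ SparseOn Gᶜ Y (u ^ 32) by
      obtain ⟨Y, hY, hYc, hYs⟩ := h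
      exact ⟨Y, hY.trans hAS, hYc, hYs⟩
    refine hG.exists_sparse_of_touching hc0 hc hd hE1 hE2 hrodl hw hS hML (by omega) hui hwM hAS
      hvA hvB ?_ hQ0 (by exact_mod_cast card_le_card hBQ) ?_ hex
    · calc u ^ M * S.card ≤ u ^ (3 * E + 4 * d + 77 + K) * S.card := by
            gcongr ?_ * _
            exact hpow hKM
        _ = u ^ (3 * E + 4 * d + 44) * (u ^ 32 * (u * (u ^ K * S.card))) := by ring
        _ ≤ u ^ (3 * E + 4 * d + 44) * (u ^ 32 * (u * T.card)) := by gcongr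
        _ ≤ u ^ (3 * E + 4 * d + 44) * (u ^ 32 * Q.card) := by gcongr
        _ ≤ u ^ (3 * E + 4 * d + 44) * A.card := by gcongr
    · intro a ha
      have := hnbr a (hAQ ha) B hBQ
      nlinarith [mul_le_mul_of_nonneg_left hQ (pow_pos hu0 16).le]

/-- If large subsets of `T` contain sets complete to almost all of `T`, then there are many large
pairwise complete sets. -/
lemma exists_complete_family {V : Type*} {G : SimpleGraph V} {T : Finset V} {m δ : ℝ} (hm : 0 < m)
    (hδ : 0 ≤ δ) (h : ∀ Q ⊆ T, (T.card : ℝ) ≤ 2 * Q.card → ∃ Y ⊆ Q, m ≤ Y.card ∧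
      ((Q.filter fun b => ¬ ∀ a ∈ Y, G.Adj b a).card : ℝ) ≤ δ * T.card) (k : ℕ)
    (hk : 2 * δ * k ≤ 1) :
    ∃ 𝓕 : Finset (Finset V), 𝓕.card = k ∧ (∀ Y ∈ 𝓕, Y ⊆ T ∧ m ≤ Y.card) ∧
      (𝓕 : Set (Finset V)).Pairwise (CompletePair G) := by
  suffices key : ∀ j ≤ k, ∃ 𝓕 : Finset (Finset V), 𝓕.card = j ∧ (∀ Y ∈ 𝓕, Y ⊆ T ∧ m ≤ Y.card) ∧
      (𝓕 : Set (Finset V)).Pairwise (CompletePair G) ∧ ∃ Q ⊆ T,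
        (T.card : ℝ) ≤ Q.card + δ * j * T.card ∧ ∀ Y ∈ 𝓕, CompletePair G Y Q by
    obtain ⟨𝓕, h1, h2, h3, -⟩ := key k le_rfl
    exact ⟨𝓕, h1, h2, h3⟩
  intro j
  induction j with
  | zero =>
    intro _
    exact ⟨∅, rfl, by simp, by simp, T, Subset.rfl, by simp, by simp⟩
  | succ j ih =>
    intro hj
    obtain ⟨𝓕, h1, h2, h3, Q, hQT, hQ, h4⟩ := ih (by omega)
    have hT0 : (0 : ℝ) ≤ T.card := by positivity
    have hjk : 2 * δ * j ≤ 1 := by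
      refine le_trans ?_ hk
      have : (j : ℝ) ≤ k := by exact_mod_cast (by omega : j ≤ k)
      gcongr
    obtain ⟨Y, hYQ, hYm, hYr⟩ := h Q hQT (by nlinarith)
    have hY0 : Y.Nonempty := by
      rw [← card_pos]
      exact_mod_cast hm.trans_le hYm
    have hYF : Y ∉ 𝓕 := by
      intro hY
      obtain ⟨y, hy⟩ := hY0
      exact G.irrefl (h4 Y hY y hy y (hYQ hy))
    refine ⟨insert Y 𝓕, by rw [card_insert_of_notMem hYF, h1], ?_, ?_,
      Q.filter fun b => ∀ a ∈ Y, G.Adj b a, (filter_subset _ _).trans hQT, ?_, ?_⟩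
    · intro Z hZ
      rcases mem_insert.1 hZ with rfl | hZ
      · exact ⟨hYQ.trans hQT, hYm⟩
      · exact h2 Z hZ
    · rw [coe_insert]
      refine h3.insert_of_notMem hYF fun Z hZ => ?_
      have hZY : CompletePair G Z Y := (h4 Z hZ).mono Subset.rfl hYQ
      exact ⟨hZY.symm, hZY⟩
    · have h5 : ((Q.filter fun b => ∀ a ∈ Y, G.Adj b a).card : ℝ) +
          (Q.filter fun b => ¬ ∀ a ∈ Y, G.Adj b a).card = Q.card := by
        exact_mod_cast card_filter_add_card_filter_not (s := Q) fun b => ∀ a ∈ Y, G.Adj b a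
      push_cast
      linarith
    · intro Z hZ
      rcases mem_insert.1 hZ with rfl | hZ
      · intro a ha b hb
        exact ((mem_filter.1 hb).2 a ha).symm
      · exact (h4 Z hZ).mono Subset.rfl (filter_subset _ _)

/-- A restricted subset of an extremal set yields a more restricted subset. -/
lemma Free.exists_more_restrictedOn {V : Type*} {G : SimpleGraph V} (hG : Free P5 G) {c : ℝ}
    (hc0 : 0 < c) (hc : c ≤ 1 / 24) {d E : ℕ} (hd : 1 ≤ d) (hE1 : 40 + 4 * d < E)
    (hE2 : 1 < 2 ^ E * c ^ (4 * d + 1))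
    (hrodl : ∀ X : Finset V, ∃ A ⊆ X, c ^ (4 * d) * X.card ≤ A.card ∧ RestrictedOn G A (c ^ 4))
    {w L K M : ℕ} (hw : 1 ≤ w) {S : Finset V} (hS : PurityExtremal w L G S) (hML : M < L)
    (hKL : 1 < 2 ^ L * c ^ (K + 1)) (hKM : 3 * E + 4 * d + 77 + K ≤ M) {i : ℕ} {u : ℝ}
    (hui : u = c ^ 2 ^ i) (hwM : w ≤ u ^ M * S.card) {T : Finset V} (hTS : T ⊆ S)
    (hTs : RestrictedOn G T (u ^ 16)) (hTK : u ^ K * S.card ≤ T.card) :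
    ∃ Y ⊆ S, u ^ M * S.card ≤ Y.card ∧ RestrictedOn G Y (u ^ 32) := by
  have hu0 : 0 < u := hui ▸ pow_pos hc0 _
  have hu24 : u ≤ 1 / 24 := by
    rw [hui]
    exact (pow_le_of_le_one hc0.le (by linarith) (by positivity)).trans hc
  have hpow : ∀ {a b : ℕ}, a ≤ b → u ^ b ≤ u ^ a := fun h =>
    pow_le_pow_of_le_one hu0.le (by linarith) h
  have hS0 : (0 : ℝ) < S.card := by exact_mod_cast hw.trans hS.1
  have hw1 : (1 : ℝ) ≤ w := by exact_mod_cast hw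
  have hTM : ∀ {a : ℕ}, a + K ≤ M → u ^ M * S.card ≤ u ^ a * T.card := fun {a} ha => by
    calc u ^ M * S.card ≤ u ^ (a + K) * S.card := by
          gcongr ?_ * _
          exact hpow ha
      _ = u ^ a * (u ^ K * S.card) := by ring
      _ ≤ _ := by gcongr
  rcases hTs with hTs | hTs
  · exfalso
    have hc16 : u ^ 16 ≤ c ^ (2 ^ i + 1) := by
      rw [hui, ← pow_mul]
      refine pow_le_pow_of_le_one hc0.le (by linarith) ?_
      have := Nat.one_le_two_pow (n := i)
      omega
    obtain ⟨𝓕, h1, h2, h3⟩ := hG.exists_family_of_sparse hc0 hc (2 ^ i) T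
      ((hw1.trans (hwM.trans (hTM (a := 16) (by omega)))).trans (by gcongr))
      fun v hv => (hTs v hv).trans (by gcongr)
    rw [← hui] at h2
    have h4 := hS.card_pow_mul_le_one hw (by omega) (Or.inr rfl) h3 (β := u ^ (K + 1))
      fun Y hY => by
        have h5 := (h2 Y hY).2
        refine ⟨(h2 Y hY).1.trans hTS, ?_, ?_⟩
        · have h6 := hwM.trans (hTM (a := 1) (by omega))
          rw [pow_one] at h6
          exact_mod_cast h6.trans h5
        · refine le_trans ?_ h5
          calc u ^ (K + 1) * S.card = u * (u ^ K * S.card) := by ring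
            _ ≤ _ := by gcongr
    have h5 : ((2 : ℝ) ^ 2 ^ i) ^ L ≤ (𝓕.card : ℝ) ^ L := by
      gcongr
      exact_mod_cast h1
    have h6 : 1 < ((2 : ℝ) ^ L * c ^ (K + 1)) ^ 2 ^ i := one_lt_pow₀ hKL (by positivity)
    have h7 : ((2 : ℝ) ^ L * c ^ (K + 1)) ^ 2 ^ i = ((2 : ℝ) ^ 2 ^ i) ^ L * u ^ (K + 1) := by
      rw [hui]
      ring
    have h8 := mul_le_mul_of_nonneg_right h5 (pow_nonneg hu0.le (K + 1))
    linarith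
  · by_contra hno
    have hblock : ∀ Q ⊆ T, (T.card : ℝ) ≤ 2 * Q.card → ∃ Y ⊆ Q, u ^ M * S.card ≤ Y.card ∧
        ((Q.filter fun b => ¬ ∀ a ∈ Y, G.Adj b a).card : ℝ) ≤ 2 * u ^ 2 * T.card := by
      intro Q hQT hQ
      rcases hG.exists_block_or_sparse hc0 hc hd hE1 hE2 hrodl hw hS hML.le hKM hui hwM hTS hTs hTK
        hQT hQ with ⟨Y, hY, hYc, hYs⟩ | h
      · exact absurd ⟨Y, hY, hYc, Or.inr hYs⟩ hno
      · exact h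
    have hk1 : u⁻¹ ≤ ⌈u⁻¹⌉₊ := Nat.le_ceil _
    have hk2 : (⌈u⁻¹⌉₊ : ℝ) < u⁻¹ + 1 := Nat.ceil_lt_add_one (by positivity)
    obtain ⟨𝓕, h1, h2, h3⟩ := exists_complete_family (by positivity) (by positivity) hblock ⌈u⁻¹⌉₊
      (by
        calc 2 * (2 * u ^ 2) * (⌈u⁻¹⌉₊ : ℝ) ≤ 2 * (2 * u ^ 2) * (u⁻¹ + 1) := by gcongr
          _ = 4 * u + 4 * u ^ 2 := by
            field_simp
            ring
          _ ≤ 1 := by nlinarith)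
    have h4 := hS.card_pow_mul_le_one hw (by omega) (Or.inl rfl) h3 (β := u ^ M)
      fun Y hY => ⟨(h2 Y hY).1.trans hTS, by exact_mod_cast hwM.trans (h2 Y hY).2, (h2 Y hY).2⟩
    rw [h1] at h4
    have h5 : u⁻¹ ^ L * u ^ M ≤ 1 := le_trans (by gcongr) h4
    rw [inv_pow, inv_mul_le_iff₀ (by positivity), mul_one] at h5
    exact absurd h5 (not_le.2 (pow_lt_pow_right_of_lt_one₀ hu0 (by linarith) hML))

lemma Free.exists_restrictedOn_of_extremal {V : Type*} {G : SimpleGraph V} (hG : Free P5 G) {c : ℝ}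
    (hc0 : 0 < c) (hc : c ≤ 1 / 24) {d E : ℕ} (hd : 1 ≤ d) (hE1 : 40 + 4 * d < E)
    (hE2 : 1 < 2 ^ E * c ^ (4 * d + 1))
    (hrodl : ∀ X : Finset V, ∃ A ⊆ X, c ^ (4 * d) * X.card ≤ A.card ∧ RestrictedOn G A (c ^ 4))
    {w L K M : ℕ} (hw : 1 ≤ w) {S : Finset V} (hS : PurityExtremal w L G S) (hML : M < L)
    (hKL : 1 < 2 ^ L * c ^ (K + 1)) (hKM : 3 * E + 4 * d + 77 + K ≤ M) (hMK : M ≤ 2 * K)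
    (hbase : ∃ A ⊆ S, c ^ K * S.card ≤ A.card ∧ RestrictedOn G A (c ^ 16)) (i : ℕ) :
    w ≤ (c ^ 2 ^ i) ^ M * S.card →
      ∃ T ⊆ S, (c ^ 2 ^ i) ^ K * S.card ≤ T.card ∧ RestrictedOn G T ((c ^ 2 ^ i) ^ 16) := by
  have hc1 : c ≤ 1 := by linarith
  induction i with
  | zero =>
    intro _
    simpa using hbase
  | succ i ih =>
    intro hi
    have hsq : c ^ 2 ^ (i + 1) = (c ^ 2 ^ i) ^ 2 := by rw [pow_succ, pow_mul]
    have hu0 : 0 ≤ c ^ 2 ^ i := by positivity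
    have hu1 : c ^ 2 ^ i ≤ 1 := pow_le_one₀ hc0.le hc1
    have hwM : (w : ℝ) ≤ (c ^ 2 ^ i) ^ M * S.card := by
      refine hi.trans ?_
      gcongr ?_ ^ M * _
      exact hsq ▸ pow_le_of_le_one hu0 hu1 two_ne_zero
    obtain ⟨T, hTS, hTK, hTs⟩ := ih hwM
    obtain ⟨Y, hYS, hYc, hYs⟩ := hG.exists_more_restrictedOn hc0 hc hd hE1 hE2 hrodl hw hS hML hKL
      hKM rfl hwM hTS hTs hTK
    refine ⟨Y, hYS, le_trans ?_ hYc, ?_⟩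
    · rw [hsq, ← pow_mul]
      gcongr ?_ * _
      exact pow_le_pow_of_le_one hu0 hu1 hMK
    · rwa [hsq, ← pow_mul]

lemma exists_purityExtremal {V : Type*} [Fintype V] {w : ℕ} (G : SimpleGraph V) (L : ℕ)
    (hw : w ≤ Fintype.card V) : ∃ S : Finset V, PurityExtremal w L G S := by
  obtain ⟨S, hS, hmax⟩ := exists_max_image (univ.filter fun X : Finset V => w ≤ X.card)
    (fun X => (X.card : ℝ) / (purity w G X : ℝ) ^ L) ⟨univ, by simpa using hw⟩
  simp only [mem_filter, mem_univ, true_and] at hS hmax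
  have hpos : ∀ X : Finset V, w ≤ X.card → (0 : ℝ) < (purity w G X : ℝ) ^ L := fun X hX =>
    pow_pos (by exact_mod_cast one_le_purity G hX) L
  refine ⟨S, hS, fun X hX => ?_⟩
  exact (div_le_div_iff₀ (hpos X hX) (hpos S hS)).1 (hmax X hX)

lemma exists_pow_two_pow_pow_le {ε : ℝ} (hε : 0 < ε) (hε2 : ε < 1 / 2) :
    ∃ i : ℕ, (((1 : ℝ) / 32) ^ 2 ^ i) ^ 16 ≤ ε ∧ ε ^ 5 ≤ ((1 : ℝ) / 32) ^ 2 ^ i := by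
  have hex : ∃ i : ℕ, (((1 : ℝ) / 32) ^ 2 ^ i) ^ 16 ≤ ε := by
    obtain ⟨n, hn⟩ := exists_pow_lt_of_lt_one hε (by norm_num : (1 : ℝ) / 32 < 1)
    refine ⟨n, le_trans ?_ hn.le⟩
    rw [← pow_mul]
    refine pow_le_pow_of_le_one (by norm_num) (by norm_num) ?_
    have := Nat.lt_two_pow_self (n := n)
    omega
  refine ⟨Nat.find hex, Nat.find_spec hex, ?_⟩
  rcases Nat.eq_zero_or_pos (Nat.find hex) with h | h
  · rw [h, pow_zero, pow_one]
    calc ε ^ 5 ≤ (1 / 2) ^ 5 := by gcongr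
      _ = 1 / 32 := by norm_num
  · obtain ⟨j, hj⟩ := Nat.exists_eq_succ_of_ne_zero h.ne'
    have h1 : ε < (((1 : ℝ) / 32) ^ 2 ^ j) ^ 16 := not_le.1 (Nat.find_min hex (by omega))
    have h2 : ((1 : ℝ) / 32) ^ 2 ^ j ≤ 1 := pow_le_one₀ (by norm_num) (by norm_num)
    have h3 : ((1 : ℝ) / 32) ^ 2 ^ Nat.find hex = (((1 : ℝ) / 32) ^ 2 ^ j) ^ 2 := by
      rw [hj, Nat.succ_eq_add_one, pow_succ, pow_mul]
    rw [h3]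
    calc ε ^ 5 ≤ ε ^ 2 := pow_le_pow_of_le_one hε.le (by linarith) (by norm_num)
      _ ≤ _ := by
        gcongr
        exact h1.le.trans (pow_le_of_le_one (by positivity) h2 (by norm_num))

/-- `P5` has the polynomial Rödl property. -/
theorem p5_poly_rodl :
    ∃ d : ℝ, 0 < d ∧
      ∀ ε : ℝ, 0 < ε → ε < 1/2 →
        ∀ (V : Type) [Fintype V] (G : SimpleGraph V),
          Free P5 G →
          ∃ S : Finset V, ε ^ d * (Fintype.card V : ℝ) ≤ (S.card : ℝ) ∧
            RestrictedOn G S ε := by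
  obtain ⟨r, hr0, -, hr⟩ := exists_restrictedOn_of_free (c := (1 / 32) ^ 4) (by norm_num)
  obtain ⟨r', hr0', -, hr'⟩ := exists_restrictedOn_of_free (c := (1 / 32) ^ 16) (by norm_num)
  obtain ⟨n, hn⟩ := exists_pow_lt_of_lt_one hr0 (by norm_num : (1 : ℝ) / 32 < 1)
  obtain ⟨n', hn'⟩ := exists_pow_lt_of_lt_one hr0' (by norm_num : (1 : ℝ) / 32 < 1)
  have hpow : ∀ {a b : ℕ}, a ≤ b → ((1 : ℝ) / 32) ^ b ≤ (1 / 32) ^ a := fun h =>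
    pow_le_pow_of_le_one (by norm_num) (by norm_num) h
  have h32 : ∀ a : ℕ, (1 : ℝ) < 2 ^ (5 * a + 1) * (1 / 32) ^ a := by
    intro a
    rw [pow_succ, pow_mul, mul_right_comm, ← mul_pow]
    norm_num
  obtain ⟨d, hd, hdn⟩ : ∃ d : ℕ, 1 ≤ d ∧ n ≤ d := ⟨n + 1, by omega, by omega⟩
  obtain ⟨E, hE1, hE2⟩ : ∃ E : ℕ, 40 + 4 * d < E ∧ (1 : ℝ) < 2 ^ E * (1 / 32) ^ (4 * d + 1) := by
    refine ⟨5 * (4 * d + 1) + 1 + 40, by omega, (h32 (4 * d + 1)).trans_le ?_⟩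
    gcongr <;> norm_num
  obtain ⟨K, hKE, hKn⟩ : ∃ K : ℕ, 3 * E + 4 * d + 77 ≤ K ∧ n' ≤ K :=
    ⟨3 * E + 4 * d + 77 + n', by omega, by omega⟩
  obtain ⟨L, hKL, hL⟩ : ∃ L : ℕ, 2 * K < L ∧ (1 : ℝ) < 2 ^ L * (1 / 32) ^ (K + 1) :=
    ⟨5 * (K + 1) + 1, by omega, h32 (K + 1)⟩
  set D : ℕ := 10 * K + 2 * L + 1 with hD
  refine ⟨(D : ℕ), by positivity, fun ε hε hε2 V _ G hG => ?_⟩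
  rw [Real.rpow_natCast]
  by_cases hsmall : ε ^ D * (Fintype.card V : ℝ) ≤ 1
  · rcases isEmpty_or_nonempty V with hV | ⟨⟨v⟩⟩
    · exact ⟨∅, by simp, Or.inl fun v => by simp⟩
    · refine ⟨{v}, by simpa using hsmall, Or.inl fun x hx => ?_⟩
      obtain rfl := mem_singleton.1 hx
      have : nbrsIn G x {x} = ∅ := by
        ext y
        simp only [mem_nbrsIn, mem_singleton, notMem_empty, iff_false, not_and]
        rintro rfl
        exact G.irrefl
      simp [this, hε.le]
  rw [not_le] at hsmall
  set w := ⌈ε ^ D * (Fintype.card V : ℝ)⌉₊ with hw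
  have hεw : ε ^ D * (Fintype.card V : ℝ) ≤ w := Nat.le_ceil _
  have hw1 : 1 ≤ w := Nat.one_le_ceil_iff.2 (by linarith)
  by_contra hno
  have hno' : ∀ U : Finset V, w ≤ U.card → ¬ RestrictedOn G U ε := fun U hU hUr =>
    hno ⟨U, hεw.trans (by exact_mod_cast hU), hUr⟩
  have hwV : w ≤ Fintype.card V :=
    Nat.ceil_le.2 (mul_le_of_le_one_left (by positivity) (pow_le_one₀ hε.le (by linarith)))
  obtain ⟨S, hS⟩ := exists_purityExtremal G L hwV
  have hSV : ε ^ (2 * L) * (Fintype.card V : ℝ) ≤ S.card := by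
    have h1 := hS.2 univ (by simpa using hwV)
    have h2 : (1 : ℝ) ≤ (purity w G S : ℝ) ^ L :=
      one_le_pow₀ (by exact_mod_cast one_le_purity G hS.1)
    have h3 : (purity w G univ : ℝ) ≤ (1 / ε) ^ 2 :=
      purity_le_of_forall_not_restrictedOn hε fun U _ => hno' U
    rw [card_univ] at h1
    have h4 : (Fintype.card V : ℝ) ≤ S.card * ((1 / ε) ^ 2) ^ L := by
      calc (Fintype.card V : ℝ) ≤ Fintype.card V * (purity w G S : ℝ) ^ L :=
            le_mul_of_one_le_right (by positivity) h2
        _ ≤ _ := h1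
        _ ≤ _ := by gcongr
    rwa [← pow_mul, one_div, inv_pow, ← div_eq_mul_inv, le_div_iff₀ (by positivity),
      mul_comm] at h4
  obtain ⟨i, hi1, hi2⟩ := exists_pow_two_pow_pow_le hε hε2
  have hwM : (w : ℝ) ≤ (((1 : ℝ) / 32) ^ 2 ^ i) ^ (2 * K) * S.card := by
    have h1 : (w : ℝ) < ε ^ D * (Fintype.card V : ℝ) + 1 := Nat.ceil_lt_add_one (by positivity)
    calc (w : ℝ) ≤ 2 * (ε ^ D * Fintype.card V) := by linarith
      _ = (2 * ε) * (ε ^ (10 * K + 2 * L) * Fintype.card V) := by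
        rw [hD]
        ring
      _ ≤ 1 * (ε ^ (10 * K + 2 * L) * Fintype.card V) := by
        gcongr
        linarith
      _ = (ε ^ 5) ^ (2 * K) * (ε ^ (2 * L) * Fintype.card V) := by ring
      _ ≤ _ := by gcongr
  obtain ⟨T, -, hTc, hTr⟩ := hG.exists_restrictedOn_of_extremal (c := 1 / 32) (by norm_num)
    (by norm_num) hd hE1 hE2 (fun X => by
      obtain ⟨A, hA, hAc, hAr⟩ := hr hG X
      refine ⟨A, hA, le_trans ?_ hAc, hAr⟩
      gcongr
      exact (hpow (by omega)).trans hn.le) hw1 hS hKL hL (by omega) le_rfl (by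
      obtain ⟨A, hA, hAc, hAr⟩ := hr' hG S
      refine ⟨A, hA, le_trans ?_ hAc, hAr⟩
      gcongr
      exact (hpow hKn).trans hn'.le) i hwM
  refine hno' T ?_ ?_
  · have h1 : (((1 : ℝ) / 32) ^ 2 ^ i) ^ (2 * K) ≤ (((1 : ℝ) / 32) ^ 2 ^ i) ^ K :=
      pow_le_pow_of_le_one (by positivity) (pow_le_one₀ (by norm_num) (by norm_num)) (by omega)
    have h2 : (w : ℝ) ≤ T.card := hwM.trans (le_trans (by gcongr) hTc)
    exact_mod_cast h2
  · exact hTr.imp (fun h => h.mono hi1) fun h => h.mono hi1
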